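/- arXiv:1101.2995 — 3 statements merged into one kernel-verified Lean document; each statement's English description precedes it below -/
import Mathlib

section
/- Let t > 1, 0 < r < 1, and let μ be a complex Borel measure on the unit disk D such that |μ| is t-Carleson: sup_{z∈D} |μ|(D(z,r))/(1-|z|²)^t < ∞. Define f(z) = ∫_D (z-w)/(1-z·conj(w)) dμ(w). Then for any integer k > t there is a constant C with |f^{(k)}(z)| ≤ C(1-|z|²)^{t-k} for all z ∈ D; i.e., f belongs to the Lipschitz space Λ_t. -/
open MeasureTheory Complex

def unitDisk : Set ℂ := {z : ℂ | ‖z‖ < 1}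

def pDisk (z : ℂ) (r : ℝ) : Set ℂ :=
  {w ∈ unitDisk | ‖(z - w) / (1 - z * (starRingEnd ℂ) w)‖ < r}

noncomputable def areaM : Measure ℂ := (ENNReal.ofReal Real.pi)⁻¹ • (volume : Measure ℂ)

lemma aux_abs_arg_le (v : ℂ) (hv : ‖v‖ < 1) (s : ℝ) (hs : ‖v - 1‖ < s) : |v.arg| ≤ Real.pi * s := by
  have hs0 : 0 < s := lt_of_le_of_lt (norm_nonneg _) hs
  by_cases h0 : v = 0
  · subst h0; simp; positivity
  have hn : 0 < ‖v‖ := norm_pos_iff.mpr h0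
  have hu : ‖((‖v‖⁻¹ : ℝ) : ℂ) * v‖ = 1 := by
    rw [norm_mul, Complex.norm_real, norm_inv, norm_norm]; field_simp
  have h1 := Complex.angle_le_mul_norm_sub hu (norm_one (α := ℂ))
  rw [Complex.angle_one_right (by rw [← norm_pos_iff, hu]; norm_num),
    Complex.arg_real_mul _ (by positivity)] at h1
  have h2 : ‖((‖v‖⁻¹ : ℝ) : ℂ) * v - v‖ = 1 - ‖v‖ := by
    have : ((‖v‖⁻¹ : ℝ) : ℂ) * v - v = ((‖v‖⁻¹ - 1 : ℝ) : ℂ) * v := by push_cast; ring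
    rw [this, norm_mul, Complex.norm_real, Real.norm_of_nonneg]
    · field_simp
    · rw [sub_nonneg]; exact (one_le_inv₀ hn).mpr hv.le
  have h3 : ‖((‖v‖⁻¹ : ℝ) : ℂ) * v - 1‖ ≤ ‖((‖v‖⁻¹ : ℝ) : ℂ) * v - v‖ + ‖v - 1‖ := by
    simpa using norm_sub_le_norm_sub_add_norm_sub (((‖v‖⁻¹ : ℝ) : ℂ) * v) v 1
  have h4 : 1 - ‖v‖ ≤ ‖v - 1‖ := by
    have := norm_sub_norm_le (1 : ℂ) v
    rwa [norm_one, norm_sub_rev] at this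
  nlinarith [Real.pi_pos]

lemma aux_dist_le (v p : ℂ) : ‖p - v‖ ≤ |‖p‖ - ‖v‖| + ‖v‖ * |p.arg - v.arg| := by
  have h1 : p - v = ((‖p‖ - ‖v‖ : ℝ) : ℂ) * Complex.exp (p.arg * I) +
      (‖v‖ : ℂ) * Complex.exp (v.arg * I) * (Complex.exp (I * ((p.arg - v.arg : ℝ) : ℂ)) - 1) := by
    have e : Complex.exp (v.arg * I) * Complex.exp (I * ((p.arg - v.arg : ℝ) : ℂ))
        = Complex.exp (p.arg * I) := by
      rw [← Complex.exp_add]; congr 1; push_cast; ring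
    have hp := Complex.norm_mul_exp_arg_mul_I p
    have hv := Complex.norm_mul_exp_arg_mul_I v
    push_cast at e ⊢
    linear_combination (-1 : ℂ) * hp + hv - (‖v‖ : ℂ) * e
  rw [h1]
  refine (norm_add_le _ _).trans ?_
  have h2 := Real.norm_exp_I_mul_ofReal_sub_one_le (x := p.arg - v.arg)
  rw [norm_mul, norm_mul, norm_mul, Complex.norm_exp_ofReal_mul_I, Complex.norm_exp_ofReal_mul_I,
    Complex.norm_real, Complex.norm_real, norm_norm, mul_one, mul_one, Real.norm_eq_abs]
  gcongr
  exact h2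

lemma aux_one_sub_le (z w : ℂ) (hz : ‖z‖ ≤ 1) :
    1 - ‖w‖ ≤ ‖1 - z * (starRingEnd ℂ) w‖ := by
  have := norm_sub_norm_le (1 : ℂ) (z * (starRingEnd ℂ) w)
  rw [norm_one, norm_mul, Complex.norm_conj] at this
  nlinarith [norm_nonneg w]

lemma aux_one_sub_le' (z w : ℂ) (hw : ‖w‖ ≤ 1) :
    1 - ‖z‖ ≤ ‖1 - z * (starRingEnd ℂ) w‖ := by
  have := norm_sub_norm_le (1 : ℂ) (z * (starRingEnd ℂ) w)
  rw [norm_one, norm_mul, Complex.norm_conj] at this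
  nlinarith [norm_nonneg z]

def auxCell (η : ℂ) (e h : ℝ) (j : ℤ) : Set ℂ :=
  {w | ‖w‖ < 1 ∧ h * (1 - e) < 1 - ‖w‖ ∧ 1 - ‖w‖ ≤ h ∧ ⌊(w / η).arg / (e * h)⌋ = j}

lemma aux_cell (t : ℝ) (ht : 1 < t) (r : ℝ) (hr0 : 0 < r) (hr1 : r < 1)
    (ν : Measure ℂ) (C₀ : ℝ) (hC₀ : 0 ≤ C₀)
    (hCar : ∀ z ∈ unitDisk, ν (pDisk z r) ≤ ENNReal.ofReal (C₀ * (1 - ‖z‖ ^ 2) ^ t))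
    (η : ℂ) (hη : ‖η‖ = 1) (h : ℝ) (hh : 0 < h) (j : ℤ) :
    ν (auxCell η (r / 5) h j) ≤ ENNReal.ofReal (C₀ * (2 * h) ^ t) := by
  rcases (auxCell η (r / 5) h j).eq_empty_or_nonempty with h0 | ⟨p, hp⟩
  · rw [h0]; simp
  have hη0 : η ≠ 0 := by rw [← norm_pos_iff, hη]; norm_num
  obtain ⟨p1, p2, p3, p4⟩ := hp
  have hsub : auxCell η (r / 5) h j ⊆ pDisk p r := by
    rintro w ⟨w1, w2, w3, w4⟩
    refine ⟨w1, ?_⟩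
    have hd := aux_dist_le (w / η) (p / η)
    rw [← sub_div, norm_div, norm_div, norm_div, hη, div_one, div_one, div_one] at hd
    have he : 0 < r / 5 * h := by positivity
    have ha : |(p / η).arg - (w / η).arg| ≤ r / 5 * h := by
      have := Int.abs_sub_lt_one_of_floor_eq_floor (p4.trans w4.symm)
      rw [← sub_div, abs_div, abs_of_pos he, div_lt_one he] at this
      exact this.le
    have hb : |‖p‖ - ‖w‖| ≤ r / 5 * h := by
      rw [abs_le]; constructor <;> nlinarith
    have hc : ‖p - w‖ ≤ 2 * (r / 5 * h) := by
      nlinarith [abs_nonneg ((p / η).arg - (w / η).arg), norm_nonneg w]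
    have hden := aux_one_sub_le' p w w1.le
    have hden0 : 0 < ‖1 - p * (starRingEnd ℂ) w‖ := by linarith
    rw [norm_div, div_lt_iff₀ hden0]
    nlinarith
  refine (measure_mono hsub).trans ((hCar p p1).trans ?_)
  apply ENNReal.ofReal_le_ofReal
  gcongr
  · nlinarith [norm_nonneg p]
  · nlinarith [norm_nonneg p]

lemma aux_box (t : ℝ) (ht : 1 < t) (r : ℝ) (hr0 : 0 < r) (hr1 : r < 1)
    (ν : Measure ℂ) (C₀ : ℝ) (hC₀ : 0 ≤ C₀)
    (hCar : ∀ z ∈ unitDisk, ν (pDisk z r) ≤ ENNReal.ofReal (C₀ * (1 - ‖z‖ ^ 2) ^ t)) :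
    ∃ C : ℝ, 0 ≤ C ∧ ∀ (η : ℂ), ‖η‖ = 1 → ∀ s : ℝ, 0 < s →
      ν (unitDisk ∩ {w | ‖w - η‖ < s}) ≤ ENNReal.ofReal (C * s ^ t) := by
  set e : ℝ := r / 5 with he
  have he0 : 0 < e := by positivity
  have he1 : e < 1 := by rw [he]; linarith
  set q : ℝ := 1 - e with hq
  have hq0 : 0 < q := by linarith
  have hq1 : q < 1 := by linarith
  set K : ℝ := 2 * (Real.pi / e) + 3 with hK
  have hK0 : 0 < K := by positivity
  have hρ1 : q ^ (t - 1) < 1 := Real.rpow_lt_one hq0.le hq1 (by linarith)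
  have hρ0 : 0 ≤ q ^ (t - 1) := by positivity
  refine ⟨K * C₀ * 2 ^ t * (1 - q ^ (t - 1))⁻¹, ?_, ?_⟩
  · have : 0 < 1 - q ^ (t - 1) := by linarith
    positivity
  intro η hη s hs
  have hη0 : η ≠ 0 := by rw [← norm_pos_iff, hη]; norm_num
  let N : ℕ → ℤ := fun n => ⌊Real.pi / e * (q ^ n)⁻¹⌋ + 1
  have hcov : unitDisk ∩ {w | ‖w - η‖ < s} ⊆
      ⋃ n : ℕ, ⋃ j ∈ Finset.Icc (-(N n)) (N n), auxCell η e (s * q ^ n) j := by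
    rintro w ⟨hw1, hw2⟩
    have hw1' : ‖w‖ < 1 := hw1
    have hw2' : ‖w - η‖ < s := hw2
    have hle : 1 - ‖w‖ < s := by
      have := norm_sub_norm_le η w
      rw [hη, norm_sub_rev] at this
      linarith
    obtain ⟨n, hn1, hn2⟩ := exists_nat_pow_near_of_lt_one (x := (1 - ‖w‖) / s) (y := q)
      (div_pos (by linarith) hs) ((div_le_one hs).mpr hle.le) hq0 hq1
    rw [lt_div_iff₀ hs] at hn1
    rw [div_le_iff₀ hs] at hn2
    have hqn : 0 < q ^ n := by positivity
    have harg : |(w / η).arg| ≤ Real.pi * s := by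
      apply aux_abs_arg_le
      · rw [norm_div, hη, div_one]; exact hw1'
      · have : w / η - 1 = (w - η) / η := by field_simp
        rw [this, norm_div, hη, div_one]; exact hw2'
    have hx : |(w / η).arg / (e * (s * q ^ n))| ≤ Real.pi / e * (q ^ n)⁻¹ := by
      have hp : 0 < e * (s * q ^ n) := by positivity
      rw [abs_div, abs_of_pos hp, div_le_iff₀ hp]
      calc _ ≤ _ := harg
        _ = _ := by field_simp
    obtain ⟨hx1, hx2⟩ := abs_le.mp hx
    simp only [Set.mem_iUnion, Finset.mem_Icc]
    refine ⟨n, ⌊(w / η).arg / (e * (s * q ^ n))⌋, ⟨?_, ?_⟩, hw1', ?_, ?_, rfl⟩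
    · rw [Int.le_floor]
      have := Int.lt_floor_add_one (Real.pi / e * (q ^ n)⁻¹)
      simp only [N]; push_cast; linarith
    · have := Int.floor_le_floor hx2
      simp only [N]; omega
    · rw [pow_succ] at hn1; nlinarith
    · linarith
  have hlayer : ∀ n : ℕ, ν (⋃ j ∈ Finset.Icc (-(N n)) (N n), auxCell η e (s * q ^ n) j) ≤
      ENNReal.ofReal (K * C₀ * 2 ^ t * s ^ t * (q ^ (t - 1)) ^ n) := by
    intro n
    have hqn : 0 < q ^ n := by positivity
    have hqn1 : q ^ n ≤ 1 := pow_le_one₀ hq0.le hq1.le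
    refine (measure_biUnion_finset_le _ _).trans ?_
    refine (Finset.sum_le_sum fun j _ => aux_cell t ht r hr0 hr1 ν C₀ hC₀ hCar η hη (s * q ^ n)
      (by positivity) j).trans ?_
    rw [Finset.sum_const, nsmul_eq_mul, Int.card_Icc, ← ENNReal.ofReal_natCast,
      ← ENNReal.ofReal_mul (by positivity)]
    apply ENNReal.ofReal_le_ofReal
    have hN0 : 0 ≤ N n := by
      have : 0 ≤ ⌊Real.pi / e * (q ^ n)⁻¹⌋ := Int.floor_nonneg.mpr (by positivity)
      simp only [N]; omega
    have hcard : (((N n + 1 - -(N n)).toNat : ℕ) : ℝ) ≤ K * (q ^ n)⁻¹ := by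
      have h1 : (((N n + 1 - -(N n)).toNat : ℕ) : ℝ) = 2 * (N n : ℝ) + 1 := by
        have : (((N n + 1 - -(N n)).toNat : ℕ) : ℤ) = 2 * N n + 1 := by omega
        exact_mod_cast this
      have h2 : (N n : ℝ) ≤ Real.pi / e * (q ^ n)⁻¹ + 1 := by
        simp only [N]; push_cast
        linarith [Int.floor_le (Real.pi / e * (q ^ n)⁻¹)]
      have h3 : 1 ≤ (q ^ n)⁻¹ := (one_le_inv₀ hqn).mpr hqn1
      rw [h1, hK]; nlinarith
    have hpow : (2 * (s * q ^ n)) ^ t = 2 ^ t * s ^ t * (q ^ n * (q ^ (t - 1)) ^ n) := by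
      rw [Real.mul_rpow (by norm_num) (by positivity), Real.mul_rpow hs.le hqn.le,
        ← mul_pow, Real.rpow_sub hq0, Real.rpow_one, mul_div_cancel₀ _ hq0.ne',
        ← Real.rpow_natCast, ← Real.rpow_natCast, ← Real.rpow_mul hq0.le, ← Real.rpow_mul hq0.le,
        mul_comm t, mul_assoc]
    calc _ ≤ K * (q ^ n)⁻¹ * (C₀ * (2 * (s * q ^ n)) ^ t) := by gcongr
      _ = _ := by rw [hpow]; field_simp
  have hsum : Summable fun n : ℕ => K * C₀ * 2 ^ t * s ^ t * (q ^ (t - 1)) ^ n :=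
    (summable_geometric_of_lt_one hρ0 hρ1).mul_left _
  refine (measure_mono hcov).trans ((measure_iUnion_le _).trans ((ENNReal.tsum_le_tsum hlayer).trans ?_))
  rw [← ENNReal.ofReal_tsum_of_nonneg (fun n => by positivity) hsum, tsum_mul_left,
    tsum_geometric_of_lt_one hρ0 hρ1]
  apply ENNReal.ofReal_le_ofReal
  apply le_of_eq; ring

lemma aux_horo (t : ℝ) (ht : 1 < t) (r : ℝ) (hr0 : 0 < r) (hr1 : r < 1)
    (ν : Measure ℂ) (C₀ : ℝ) (hC₀ : 0 ≤ C₀)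
    (hCar : ∀ z ∈ unitDisk, ν (pDisk z r) ≤ ENNReal.ofReal (C₀ * (1 - ‖z‖ ^ 2) ^ t)) :
    ∃ C : ℝ, 0 ≤ C ∧ ∀ z ∈ unitDisk, ∀ s : ℝ, 0 < s →
      ν (unitDisk ∩ {w | ‖1 - z * (starRingEnd ℂ) w‖ < s}) ≤ ENNReal.ofReal (C * s ^ t) := by
  obtain ⟨C, hC, h⟩ := aux_box t ht r hr0 hr1 ν C₀ hC₀ hCar
  refine ⟨C * 2 ^ t, by positivity, ?_⟩
  intro z hz s hs
  have hz' : ‖z‖ < 1 := hz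
  obtain ⟨η, hη, hzη⟩ : ∃ η : ℂ, ‖η‖ = 1 ∧ z = (‖z‖ : ℂ) * η := by
    refine ⟨Complex.exp (z.arg * I), Complex.norm_exp_ofReal_mul_I _, ?_⟩
    rw [Complex.norm_mul_exp_arg_mul_I]
  have hsub : unitDisk ∩ {w | ‖1 - z * (starRingEnd ℂ) w‖ < s} ⊆
      unitDisk ∩ {w | ‖w - η‖ < 2 * s} := by
    rintro w ⟨hw, hw2⟩
    refine ⟨hw, ?_⟩
    have hw' : ‖w‖ < 1 := hw
    have hw2' : ‖1 - z * (starRingEnd ℂ) w‖ < s := hw2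
    have h1 := aux_one_sub_le' z w hw'.le
    have hηη : η * (starRingEnd ℂ) η = 1 := by
      rw [Complex.mul_conj, Complex.normSq_eq_norm_sq, hη]; norm_num
    have h2 : ‖w - η‖ = ‖1 - η * (starRingEnd ℂ) w‖ := by
      have : 1 - η * (starRingEnd ℂ) w = - (η * (starRingEnd ℂ) (w - η)) := by
        rw [map_sub]; linear_combination -hηη
      rw [this, norm_neg, norm_mul, hη, one_mul, Complex.norm_conj]
    have h3 : ‖(z - η) * (starRingEnd ℂ) w‖ ≤ 1 - ‖z‖ := by
      have : z - η = -(((1 - ‖z‖ : ℝ) : ℂ) * η) := by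
        push_cast; linear_combination hzη
      rw [norm_mul, Complex.norm_conj, this, norm_neg, norm_mul, hη, Complex.norm_real,
        Real.norm_of_nonneg (by linarith)]
      nlinarith [norm_nonneg w]
    have h4 : 1 - η * (starRingEnd ℂ) w = (1 - z * (starRingEnd ℂ) w) + (z - η) * (starRingEnd ℂ) w := by
      ring
    have h5 := norm_add_le (1 - z * (starRingEnd ℂ) w) ((z - η) * (starRingEnd ℂ) w)
    rw [← h4, ← h2] at h5
    show ‖w - η‖ < 2 * s
    linarith
  refine (measure_mono hsub).trans ((h η hη (2 * s) (by positivity)).trans ?_)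
  rw [Real.mul_rpow (by norm_num) hs.le, mul_assoc]

lemma aux_lint (t : ℝ) (k : ℕ) (hk : t < k)
    (ν : Measure ℂ) (hνD : ν unitDiskᶜ = 0) (C : ℝ) (hC : 0 ≤ C)
    (h : ∀ z ∈ unitDisk, ∀ s : ℝ, 0 < s →
      ν (unitDisk ∩ {w | ‖1 - z * (starRingEnd ℂ) w‖ < s}) ≤ ENNReal.ofReal (C * s ^ t)) :
    ∃ C' : ℝ, 0 < C' ∧ ∀ z ∈ unitDisk,
      ∫⁻ w, ENNReal.ofReal ((‖1 - z * (starRingEnd ℂ) w‖ ^ k)⁻¹) ∂ν ≤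
        ENNReal.ofReal (C' * (1 - ‖z‖ ^ 2) ^ (t - k)) := by
  set ρ : ℝ := (2 : ℝ) ^ (t - k) with hρ
  have hρ0 : 0 ≤ ρ := by positivity
  have hρ1 : ρ < 1 := Real.rpow_lt_one_of_one_lt_of_neg (by norm_num) (by linarith)
  have hρ2 : 0 < 1 - ρ := by linarith
  refine ⟨(C + 1) * 2 ^ t * (1 - ρ)⁻¹ * 2 ^ (k - t), by positivity, ?_⟩
  intro z hz
  have hz' : ‖z‖ < 1 := hz
  set δ : ℝ := 1 - ‖z‖ with hδ
  have hδ0 : 0 < δ := by linarith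
  let S : ℕ → Set ℂ := fun j => unitDisk ∩
    {w | 2 ^ j * δ ≤ ‖1 - z * (starRingEnd ℂ) w‖ ∧ ‖1 - z * (starRingEnd ℂ) w‖ < 2 ^ (j + 1) * δ}
  have hDm : MeasurableSet unitDisk := measurableSet_lt measurable_norm measurable_const
  have hmeas : Measurable fun w : ℂ => ‖1 - z * (starRingEnd ℂ) w‖ := by
    apply Continuous.measurable; fun_prop
  have hSm : ∀ j, MeasurableSet (S j) := fun j =>
    hDm.inter ((measurableSet_le measurable_const hmeas).inter
      (measurableSet_lt hmeas measurable_const))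
  have hcov : (⋃ j, S j) =ᵐ[ν] (Set.univ : Set ℂ) := by
    rw [Filter.eventuallyEq_univ, mem_ae_iff]
    refine measure_mono_null ?_ hνD
    rw [Set.compl_subset_compl]
    intro w hw
    have hw' : ‖w‖ < 1 := hw
    obtain ⟨n, hn1, hn2⟩ := exists_nat_pow_near
      (x := ‖1 - z * (starRingEnd ℂ) w‖ / δ) (y := (2 : ℝ))
      ((one_le_div hδ0).mpr (aux_one_sub_le' z w hw'.le)) (by norm_num)
    rw [Set.mem_iUnion]
    exact ⟨n, hw, (le_div_iff₀ hδ0).mp hn1, (div_lt_iff₀ hδ0).mp hn2⟩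
  rw [← setLIntegral_univ, ← setLIntegral_congr hcov]
  refine (lintegral_iUnion_le _ _).trans ?_
  have hlayer : ∀ j : ℕ, ∫⁻ w in S j, ENNReal.ofReal ((‖1 - z * (starRingEnd ℂ) w‖ ^ k)⁻¹) ∂ν ≤
      ENNReal.ofReal ((C + 1) * 2 ^ t * δ ^ (t - k) * ρ ^ j) := by
    intro j
    have hp : 0 < 2 ^ j * δ := by positivity
    have h1 : ∫⁻ w in S j, ENNReal.ofReal ((‖1 - z * (starRingEnd ℂ) w‖ ^ k)⁻¹) ∂ν ≤
        ∫⁻ w in S j, ENNReal.ofReal (((2 ^ j * δ) ^ k)⁻¹) ∂ν := by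
      refine setLIntegral_mono' (hSm j) ?_
      rintro w ⟨_, hw, _⟩
      apply ENNReal.ofReal_le_ofReal
      gcongr
    refine h1.trans ?_
    rw [setLIntegral_const]
    have h2 : ν (S j) ≤ ENNReal.ofReal (C * (2 ^ (j + 1) * δ) ^ t) := by
      refine (measure_mono ?_).trans (h z hz (2 ^ (j + 1) * δ) (by positivity))
      rintro w ⟨hw1, _, hw2⟩
      exact ⟨hw1, hw2⟩
    refine (mul_le_mul_right h2 _).trans ?_
    rw [← ENNReal.ofReal_mul (by positivity)]
    apply ENNReal.ofReal_le_ofReal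
    have e1 : (2 ^ (j + 1) * δ) ^ t = 2 ^ t * (2 ^ j * δ) ^ t := by
      rw [← Real.mul_rpow (by norm_num) hp.le]; congr 1; ring
    have e2 : ((2 ^ j * δ) ^ k)⁻¹ * (2 ^ j * δ) ^ t = δ ^ (t - k) * ρ ^ j := by
      rw [← Real.rpow_natCast (2 ^ j * δ) k, inv_mul_eq_div, ← Real.rpow_sub hp,
        Real.mul_rpow (by positivity) hδ0.le, mul_comm, hρ, ← Real.rpow_natCast,
        ← Real.rpow_natCast, ← Real.rpow_mul (by norm_num), ← Real.rpow_mul (by norm_num),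
        mul_comm (j : ℝ)]
    calc ((2 ^ j * δ) ^ k)⁻¹ * (C * (2 ^ (j + 1) * δ) ^ t)
        = C * 2 ^ t * (((2 ^ j * δ) ^ k)⁻¹ * (2 ^ j * δ) ^ t) := by rw [e1]; ring
      _ ≤ (C + 1) * 2 ^ t * (δ ^ (t - k) * ρ ^ j) := by
          rw [e2]; gcongr; linarith
      _ = _ := by ring
  refine (ENNReal.tsum_le_tsum hlayer).trans ?_
  rw [← ENNReal.ofReal_tsum_of_nonneg (fun n => by positivity)
    ((summable_geometric_of_lt_one hρ0 hρ1).mul_left _), tsum_mul_left,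
    tsum_geometric_of_lt_one hρ0 hρ1]
  apply ENNReal.ofReal_le_ofReal
  have h3 : 0 < 1 - ‖z‖ ^ 2 := by nlinarith [norm_nonneg z]
  have h4 : δ ^ (t - k) ≤ 2 ^ (k - t) * (1 - ‖z‖ ^ 2) ^ (t - k) := by
    have : ((1 - ‖z‖ ^ 2) / 2) ^ (t - k) = 2 ^ (k - t) * (1 - ‖z‖ ^ 2) ^ (t - k) := by
      rw [Real.div_rpow h3.le (by norm_num), div_eq_mul_inv, ← Real.rpow_neg (by norm_num), neg_sub,
        mul_comm]
    rw [← this]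
    apply Real.rpow_le_rpow_of_nonpos (by positivity) _ (by linarith)
    nlinarith [norm_nonneg z]
  calc (C + 1) * 2 ^ t * δ ^ (t - k) * (1 - ρ)⁻¹
      ≤ (C + 1) * 2 ^ t * (2 ^ (k - t) * (1 - ‖z‖ ^ 2) ^ (t - k)) * (1 - ρ)⁻¹ := by gcongr
    _ = _ := by ring

/-- Differentiation under the integral sign on the disk. -/
lemma aux_diff (ν : Measure ℂ) [IsFiniteMeasure ν] (hνD : ν unitDiskᶜ = 0)
    (F F' : ℂ → ℂ → ℂ) (hF : ∀ z, Measurable (F z)) (hF' : ∀ z, Measurable (F' z))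
    (A : ℝ) (m : ℕ)
    (hd : ∀ z ∈ unitDisk, ∀ w ∈ unitDisk, HasDerivAt (fun z => F z w) (F' z w) z)
    (hb : ∀ z ∈ unitDisk, ∀ w ∈ unitDisk, ‖F z w‖ ≤ A * ((1 - ‖z‖) ^ m)⁻¹)
    (hA : 0 ≤ A)
    (hb' : ∀ z ∈ unitDisk, ∀ w ∈ unitDisk, ‖F' z w‖ ≤ A * ((1 - ‖z‖) ^ m)⁻¹)
    (z : ℂ) (hz : z ∈ unitDisk) :
    HasDerivAt (fun z => ∫ w, F z w ∂ν) (∫ w, F' z w ∂ν) z := by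
  have hz' : ‖z‖ < 1 := hz
  have hae : ∀ᵐ w ∂ν, w ∈ unitDisk := by
    rw [ae_iff]; exact hνD
  have hsub : ∀ x ∈ Metric.ball z ((1 - ‖z‖) / 2), (1 - ‖z‖) / 2 ≤ 1 - ‖x‖ := by
    intro x hx
    rw [Metric.mem_ball, dist_eq_norm] at hx
    have := norm_sub_norm_le x z
    linarith
  have hsub' : ∀ x ∈ Metric.ball z ((1 - ‖z‖) / 2), x ∈ unitDisk := by
    intro x hx
    have := hsub x hx
    show ‖x‖ < 1
    linarith
  refine (hasDerivAt_integral_of_dominated_loc_of_deriv_le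
    (s := Metric.ball z ((1 - ‖z‖) / 2)) (bound := fun _ => A * (((1 - ‖z‖) / 2) ^ m)⁻¹)
    (Metric.ball_mem_nhds _ (by linarith)) (.of_forall fun x => (hF x).aestronglyMeasurable)
    ?_ (hF' z).aestronglyMeasurable ?_ (integrable_const _) ?_).2
  · refine Integrable.of_bound (hF z).aestronglyMeasurable (A * ((1 - ‖z‖) ^ m)⁻¹) ?_
    filter_upwards [hae] with w hw using hb z hz w hw
  · filter_upwards [hae] with w hw x hx
    refine (hb' x (hsub' x hx) w hw).trans ?_
    have := hsub x hx
    have h0 : 0 < (1 - ‖z‖) / 2 := by linarith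
    gcongr
  · filter_upwards [hae] with w hw x hx using hd x (hsub' x hx) w hw

noncomputable def auxK (n : ℕ) (z w : ℂ) : ℂ :=
  ((n + 1).factorial : ℂ) * (starRingEnd ℂ) w ^ n * (1 - w * (starRingEnd ℂ) w) /
    (1 - z * (starRingEnd ℂ) w) ^ (n + 2)

lemma aux_ne (z w : ℂ) (hz : z ∈ unitDisk) (hw : w ∈ unitDisk) :
    1 - z * (starRingEnd ℂ) w ≠ 0 := by
  have hz' : ‖z‖ < 1 := hz
  have hw' : ‖w‖ < 1 := hw
  have := aux_one_sub_le' z w hw'.le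
  rw [← norm_pos_iff]; linarith

lemma aux_num (w : ℂ) (hw : w ∈ unitDisk) : ‖1 - w * (starRingEnd ℂ) w‖ = 1 - ‖w‖ ^ 2 := by
  have hw' : ‖w‖ < 1 := hw
  rw [Complex.mul_conj, Complex.normSq_eq_norm_sq]
  rw [show (1 : ℂ) - ((‖w‖ ^ 2 : ℝ) : ℂ) = ((1 - ‖w‖ ^ 2 : ℝ) : ℂ) by push_cast; ring]
  rw [Complex.norm_real, Real.norm_of_nonneg]
  nlinarith [norm_nonneg w]

lemma aux_K_le (n : ℕ) (z w : ℂ) (hz : z ∈ unitDisk) (hw : w ∈ unitDisk) :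
    ‖auxK n z w‖ ≤ 2 * (n + 1).factorial * (‖1 - z * (starRingEnd ℂ) w‖ ^ (n + 1))⁻¹ := by
  have hz' : ‖z‖ < 1 := hz
  have hw' : ‖w‖ < 1 := hw
  have hp : 0 < ‖1 - z * (starRingEnd ℂ) w‖ := norm_pos_iff.mpr (aux_ne z w hz hw)
  have h1 := aux_one_sub_le z w hz'.le
  have h2 : ‖w‖ ^ n ≤ 1 := pow_le_one₀ (norm_nonneg _) hw'.le
  unfold auxK
  rw [norm_div, norm_mul, norm_mul, norm_pow, norm_pow, Complex.norm_conj, aux_num w hw,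
    Complex.norm_natCast, div_le_iff₀ (by positivity)]
  have h3 : 1 - ‖w‖ ^ 2 ≤ 2 * ‖1 - z * (starRingEnd ℂ) w‖ := by nlinarith [norm_nonneg w]
  have h4 : 0 ≤ 1 - ‖w‖ ^ 2 := by nlinarith [norm_nonneg w]
  calc ((n + 1).factorial : ℝ) * ‖w‖ ^ n * (1 - ‖w‖ ^ 2)
      ≤ (n + 1).factorial * 1 * (2 * ‖1 - z * (starRingEnd ℂ) w‖) := by gcongr
    _ = _ := by field_simp; ring

lemma aux_K_le' (n : ℕ) (z w : ℂ) (hz : z ∈ unitDisk) (hw : w ∈ unitDisk) :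
    ‖auxK n z w‖ ≤ 2 * (n + 1).factorial * ((1 - ‖z‖) ^ (n + 1))⁻¹ := by
  have hz' : ‖z‖ < 1 := hz
  have hw' : ‖w‖ < 1 := hw
  refine (aux_K_le n z w hz hw).trans ?_
  have h1 := aux_one_sub_le' z w hw'.le
  have : 0 < 1 - ‖z‖ := by linarith
  gcongr

lemma aux_K_deriv (n : ℕ) (z w : ℂ) (hz : z ∈ unitDisk) (hw : w ∈ unitDisk) :
    HasDerivAt (fun z => auxK n z w) (auxK (n + 1) z w) z := by
  have h0 := aux_ne z w hz hw
  have h1 : HasDerivAt (fun z : ℂ => 1 - z * (starRingEnd ℂ) w) (-(starRingEnd ℂ) w) z := by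
    simpa using ((hasDerivAt_id z).mul_const ((starRingEnd ℂ) w)).const_sub 1
  have h2 := (h1.pow (n + 2)).inv (pow_ne_zero _ h0)
  have h3 := h2.const_mul (((n + 1).factorial : ℂ) * (starRingEnd ℂ) w ^ n * (1 - w * (starRingEnd ℂ) w))
  refine h3.congr_deriv ?_
  unfold auxK
  rw [Nat.factorial_succ (n + 1)]
  simp only [Nat.add_succ_sub_one, Pi.pow_apply]
  generalize 1 - z * (starRingEnd ℂ) w = X at h0 ⊢
  push_cast
  field_simp
  ring

lemma aux_K0_deriv (z w : ℂ) (hz : z ∈ unitDisk) (hw : w ∈ unitDisk) :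
    HasDerivAt (fun z => (z - w) / (1 - z * (starRingEnd ℂ) w)) (auxK 0 z w) z := by
  have h0 := aux_ne z w hz hw
  have h1 : HasDerivAt (fun z : ℂ => 1 - z * (starRingEnd ℂ) w) (-(starRingEnd ℂ) w) z := by
    simpa using ((hasDerivAt_id z).mul_const ((starRingEnd ℂ) w)).const_sub 1
  have h2 := ((hasDerivAt_id z).sub_const w).div h1 h0
  refine h2.congr_deriv ?_
  unfold auxK
  simp
  field_simp
  ring

lemma aux_K_meas (n : ℕ) (z : ℂ) : Measurable (auxK n z) := by
  have hc : Measurable (fun w : ℂ => (starRingEnd ℂ) w) := Complex.continuous_conj.measurable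
  unfold auxK
  fun_prop

theorem stmt9 (t : ℝ) (ht : 1 < t) (r : ℝ) (hr0 : 0 < r) (hr1 : r < 1)
    (ν : Measure ℂ) (hνD : ν unitDiskᶜ = 0)
    (C₀ : ℝ)
    (hCar : ∀ z ∈ unitDisk, ν (pDisk z r) ≤ ENNReal.ofReal (C₀ * (1 - ‖z‖ ^ 2) ^ t))
    (g : ℂ → ℂ) (hg : Measurable g) (hg1 : ∀ w, ‖g w‖ ≤ 1)
    (f : ℂ → ℂ)
    (hf : ∀ z ∈ unitDisk,
      f z = ∫ w, ((z - w) / (1 - z * (starRingEnd ℂ) w)) * g w ∂ν)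
    (k : ℕ) (hk : t < k) :
    ∃ C : ℝ, 0 < C ∧ ∀ z ∈ unitDisk,
      ‖iteratedDeriv k f z‖ ≤ C * (1 - ‖z‖ ^ 2) ^ (t - k) := by
  have hCar' : ∀ z ∈ unitDisk, ν (pDisk z r) ≤ ENNReal.ofReal (|C₀| * (1 - ‖z‖ ^ 2) ^ t) := by
    intro z hz
    have hz' : ‖z‖ < 1 := hz
    have : 0 ≤ 1 - ‖z‖ ^ 2 := by nlinarith [norm_nonneg z]
    refine (hCar z hz).trans (ENNReal.ofReal_le_ofReal ?_)
    gcongr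
    exact le_abs_self _
  obtain ⟨C, hC, hH⟩ := aux_horo t ht r hr0 hr1 ν |C₀| (abs_nonneg _) hCar'
  have hfin : IsFiniteMeasure ν := by
    constructor
    have h1 := hH 0 (by simp [unitDisk]) 2 (by norm_num)
    have h2 : unitDisk ∩ {w | ‖1 - 0 * (starRingEnd ℂ) w‖ < 2} = unitDisk := by
      ext w; simp
    rw [h2] at h1
    calc ν Set.univ ≤ ν unitDisk + ν unitDiskᶜ := by
          rw [← Set.union_compl_self unitDisk]; exact measure_union_le _ _
      _ < ⊤ := by rw [hνD, add_zero]; exact h1.trans_lt ENNReal.ofReal_lt_top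
  obtain ⟨C', hC', hL⟩ := aux_lint t k hk ν hνD C hC hH
  have hopen : IsOpen unitDisk := isOpen_lt continuous_norm continuous_const
  have hae : ∀ᵐ w ∂ν, w ∈ unitDisk := by
    rw [ae_iff]; exact hνD
  have hcm : Measurable (fun w : ℂ => (starRingEnd ℂ) w) := Complex.continuous_conj.measurable
  have hiter : ∀ n : ℕ, ∀ z ∈ unitDisk, iteratedDeriv (n + 1) f z = ∫ w, auxK n z w * g w ∂ν := by
    intro n
    induction n with
    | zero =>
      intro z hz
      rw [zero_add, iteratedDeriv_one]
      have hD := aux_diff ν hνD (fun z w => ((z - w) / (1 - z * (starRingEnd ℂ) w)) * g w)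
        (fun z w => auxK 0 z w * g w) (fun z => by fun_prop)
        (fun z => (aux_K_meas 0 z).mul hg) 2 1
        (fun z hz w hw => (aux_K0_deriv z w hz hw).mul_const (g w)) ?_ (by norm_num) ?_ z hz
      · refine (hD.congr_of_eventuallyEq ?_).deriv
        filter_upwards [hopen.mem_nhds hz] with x hx using hf x hx
      · intro z hz w hw
        have hz' : ‖z‖ < 1 := hz
        have hw' : ‖w‖ < 1 := hw
        have h1 := aux_one_sub_le' z w hw'.le
        have h0 : 0 < 1 - ‖z‖ := by linarith
        rw [norm_mul, norm_div, pow_one, ← div_eq_mul_inv]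
        have h2 : ‖z - w‖ ≤ 2 := (norm_sub_le _ _).trans (by linarith)
        calc _ ≤ 2 / (1 - ‖z‖) * 1 := by gcongr; exact hg1 w
          _ = _ := by ring
      · intro z hz w hw
        rw [norm_mul]
        have h1 := aux_K_le' 0 z w hz hw
        have h2 := mul_le_mul_of_nonneg_left (hg1 w) (norm_nonneg (auxK 0 z w))
        simp at h1 h2 ⊢
        linarith
    | succ n ih =>
      intro z hz
      rw [iteratedDeriv_succ]
      have hD := aux_diff ν hνD (fun z w => auxK n z w * g w)
        (fun z w => auxK (n + 1) z w * g w) (fun z => (aux_K_meas n z).mul hg)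
        (fun z => (aux_K_meas (n + 1) z).mul hg) (2 * (n + 2).factorial) (n + 2)
        (fun z hz w hw => (aux_K_deriv n z w hz hw).mul_const (g w)) ?_ (by positivity) ?_ z hz
      · refine (hD.congr_of_eventuallyEq ?_).deriv
        filter_upwards [hopen.mem_nhds hz] with x hx using ih x hx
      · intro z hz w hw
        have hz' : ‖z‖ < 1 := hz
        have h0 : 0 < 1 - ‖z‖ := by linarith
        rw [norm_mul]
        have h1 := aux_K_le' n z w hz hw
        have h2 := mul_le_mul_of_nonneg_left (hg1 w) (norm_nonneg (auxK n z w))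
        rw [mul_one] at h2
        refine h2.trans (h1.trans ?_)
        have h3 : (1 - ‖z‖) ^ (n + 2) ≤ (1 - ‖z‖) ^ (n + 1) :=
          pow_le_pow_of_le_one h0.le (by linarith [norm_nonneg z]) (by omega)
        have h4 : (n + 1).factorial ≤ (n + 2).factorial := Nat.factorial_le (by omega)
        gcongr
      · intro z hz w hw
        rw [norm_mul]
        have h1 := aux_K_le' (n + 1) z w hz hw
        have h2 := mul_le_mul_of_nonneg_left (hg1 w) (norm_nonneg (auxK (n + 1) z w))
        rw [mul_one] at h2
        exact h2.trans h1
  have hk1 : 0 < k := by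
    have : (0 : ℝ) < k := by linarith
    exact_mod_cast this
  obtain ⟨n, rfl⟩ : ∃ n, k = n + 1 := ⟨k - 1, by omega⟩
  refine ⟨2 * (n + 1).factorial * C', by positivity, ?_⟩
  intro z hz
  have hz' : ‖z‖ < 1 := hz
  have h3 : 0 < 1 - ‖z‖ ^ 2 := by nlinarith [norm_nonneg z]
  rw [hiter n z hz]
  refine (norm_integral_le_lintegral_norm _).trans ?_
  refine ENNReal.toReal_le_of_le_ofReal (by positivity) ?_
  calc ∫⁻ w, ENNReal.ofReal ‖auxK n z w * g w‖ ∂ν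
      ≤ ∫⁻ w, ENNReal.ofReal (2 * (n + 1).factorial) *
          ENNReal.ofReal ((‖1 - z * (starRingEnd ℂ) w‖ ^ (n + 1))⁻¹) ∂ν := by
        apply lintegral_mono_ae
        filter_upwards [hae] with w hw
        rw [← ENNReal.ofReal_mul (by positivity)]
        apply ENNReal.ofReal_le_ofReal
        rw [norm_mul]
        have h2 := mul_le_mul_of_nonneg_left (hg1 w) (norm_nonneg (auxK n z w))
        rw [mul_one] at h2
        exact h2.trans (aux_K_le n z w hz hw)
    _ = ENNReal.ofReal (2 * (n + 1).factorial) *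
          ∫⁻ w, ENNReal.ofReal ((‖1 - z * (starRingEnd ℂ) w‖ ^ (n + 1))⁻¹) ∂ν := by
        rw [lintegral_const_mul' _ _ ENNReal.ofReal_ne_top]
    _ ≤ ENNReal.ofReal (2 * (n + 1).factorial) *
          ENNReal.ofReal (C' * (1 - ‖z‖ ^ 2) ^ (t - (n + 1 : ℕ))) := by
        gcongr
        exact hL z hz
    _ = _ := by
        rw [← ENNReal.ofReal_mul (by positivity)]; congr 1; ring
end

section
/- Let 0 < p ≤ 1, let {z_n} be a sequence in the unit disk D, let {c_n} ∈ l^p, and let k be a positive integer with pk > 1. Then the function g(z) = Σ_n c_n (1-|z_n|²)/(1 - z·conj(z_n))^{k+1} satisfies ∫_D |g(z)|^p (1-|z|²)^{pk-2} dA(z) ≤ C Σ_n |c_n|^p for a constant C depending only on p and k. -/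
open MeasureTheory Complex

lemma fr_oneD (s q δ : ℝ) (hs : -1 < s) (hq : 0 < q) (hδ : 0 < δ) :
    ∫⁻ x in Set.Ioi (0:ℝ), ENNReal.ofReal (x ^ s * (max x δ) ^ (-(1 + s + q))) ≤
      ENNReal.ofReal ((1 / (s + 1) + 1 / q) * δ ^ (-q)) := by
  have hU : Set.Ioi (0:ℝ) = Set.Ioc 0 δ ∪ Set.Ioi δ := (Set.Ioc_union_Ioi_eq_Ioi hδ.le).symm
  have h1 : ∫⁻ x in Set.Ioc (0:ℝ) δ, ENNReal.ofReal (x ^ s * (max x δ) ^ (-(1 + s + q)))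
      = ENNReal.ofReal (1 / (s + 1) * δ ^ (-q)) := by
    have e : ∫⁻ x in Set.Ioc (0:ℝ) δ, ENNReal.ofReal (x ^ s * (max x δ) ^ (-(1 + s + q)))
        = ∫⁻ x in Set.Ioc (0:ℝ) δ, ENNReal.ofReal (x ^ s * δ ^ (-(1 + s + q))) := by
      refine setLIntegral_congr_fun measurableSet_Ioc ?_
      intro x hx
      simp only [max_eq_right hx.2]
    have hi : IntervalIntegrable (fun x : ℝ => x ^ s) volume 0 δ :=
      intervalIntegral.intervalIntegrable_rpow' hs
    rw [e, ← ofReal_integral_eq_lintegral_ofReal]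
    · rw [← intervalIntegral.integral_of_le hδ.le, intervalIntegral.integral_mul_const,
        integral_rpow (Or.inl hs), Real.zero_rpow (by linarith)]
      congr 1
      have : δ ^ (-q) = δ ^ (s + 1) * δ ^ (-(1 + s + q)) := by
        rw [← Real.rpow_add hδ]; congr 1; ring
      rw [this]; ring
    · exact ((intervalIntegrable_iff_integrableOn_Ioc_of_le hδ.le).1 hi).mul_const _
    · refine (ae_restrict_iff' measurableSet_Ioc).2 (Filter.Eventually.of_forall ?_)
      intro x hx
      have := hx.1
      simp only [Pi.zero_apply]
      positivity
  have h2 : ∫⁻ x in Set.Ioi δ, ENNReal.ofReal (x ^ s * (max x δ) ^ (-(1 + s + q)))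
      = ENNReal.ofReal (1 / q * δ ^ (-q)) := by
    have e : ∫⁻ x in Set.Ioi δ, ENNReal.ofReal (x ^ s * (max x δ) ^ (-(1 + s + q)))
        = ∫⁻ x in Set.Ioi δ, ENNReal.ofReal (x ^ (-(1 + q))) := by
      refine setLIntegral_congr_fun measurableSet_Ioi ?_
      intro x hx
      have hx' : δ < x := hx
      simp only [max_eq_left hx'.le]
      rw [← Real.rpow_add (hδ.trans hx')]
      congr 2; ring
    rw [e, ← ofReal_integral_eq_lintegral_ofReal]
    · rw [integral_Ioi_rpow_of_lt (by linarith) hδ]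
      congr 1
      have : -(1 + q) + 1 = -q := by ring
      rw [this]
      field_simp
    · exact integrableOn_Ioi_rpow_of_lt (by linarith) hδ
    · refine (ae_restrict_iff' measurableSet_Ioi).2 (Filter.Eventually.of_forall ?_)
      intro x hx
      have : 0 < x := hδ.trans hx
      simp only [Pi.zero_apply]
      positivity
  rw [hU]
  refine (lintegral_union_le _ _ _).trans ?_
  have : 0 < s + 1 := by linarith
  rw [h1, h2, ← ENNReal.ofReal_add (by positivity) (by positivity), add_mul]

lemma lintegral_abs_le (H : ℝ → ENNReal) :
    ∫⁻ x, H |x| ≤ 2 * ∫⁻ x in Set.Ioi (0:ℝ), H x := by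
  have hp : ∫⁻ x in Set.Ioi (0:ℝ), H |x| = ∫⁻ x in Set.Ioi (0:ℝ), H x := by
    refine setLIntegral_congr_fun measurableSet_Ioi ?_
    intro x hx
    simp only [abs_of_pos (show 0 < x from hx)]
  have hn : ∫⁻ x in Set.Iio (0:ℝ), H |x| = ∫⁻ x in Set.Ioi (0:ℝ), H |x| := by
    rw [← lintegral_indicator measurableSet_Iio, ← lintegral_indicator measurableSet_Ioi,
      ← lintegral_neg_eq_self]
    congr 1
    ext x
    simp [Set.indicator]
  have hsplit : ∫⁻ x, H |x| = ∫⁻ x in Set.Iio (0:ℝ) ∪ Set.Ioi 0, H |x| := by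
    rw [Set.Iio_union_Ioi, restrict_compl_singleton]
  rw [hsplit]
  refine (lintegral_union_le _ _ _).trans ?_
  rw [hn, hp, two_mul]

lemma fr_lower (r a θ : ℝ) (hr0 : 0 ≤ r) (hr1 : r < 1) (ha0 : 0 ≤ a) (ha1 : a < 1)
    (hθ : |θ| ≤ Real.pi) :
    1 - r ≤ ‖1 - (r * Complex.exp (θ * I)) * (a:ℂ)‖ ∧
    1 - a ≤ ‖1 - (r * Complex.exp (θ * I)) * (a:ℂ)‖ ∧
    |θ| / Real.pi ≤ ‖1 - (r * Complex.exp (θ * I)) * (a:ℂ)‖ := by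
  set w := (r * Complex.exp (θ * I)) * (a:ℂ) with hw
  have hn : ‖w‖ = r * a := by
    rw [hw]; simp [Complex.norm_exp_ofReal_mul_I, abs_of_nonneg hr0, abs_of_nonneg ha0]
  have h1 : 1 - r * a ≤ ‖1 - w‖ := by
    have := norm_sub_norm_le (1:ℂ) w
    rw [hn] at this; simpa using this
  refine ⟨by nlinarith, by nlinarith, ?_⟩
  have h2 : ‖1 - Complex.exp (θ * I)‖ ≤ 2 * ‖1 - w‖ := by
    have e : 1 - Complex.exp (θ * I) = (1 - w) + (-((1 - r * a : ℝ) : ℂ)) * Complex.exp (θ * I) := by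
      rw [hw]; push_cast; ring
    have hh : ‖(-((1 - r * a : ℝ) : ℂ)) * Complex.exp (θ * I)‖ = 1 - r * a := by
      rw [norm_mul, Complex.norm_exp_ofReal_mul_I, norm_neg, Complex.norm_real, Real.norm_eq_abs,
        abs_of_nonneg (by nlinarith), mul_one]
    rw [e]
    refine (norm_add_le _ _).trans ?_
    rw [hh]; linarith
  have h3 : ‖1 - Complex.exp (θ * I)‖ = 2 * |Real.sin (θ / 2)| := by
    rw [norm_sub_rev, mul_comm (θ:ℂ) I, Complex.norm_exp_I_mul_ofReal_sub_one]
    simp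
  have h4 := Real.mul_abs_le_abs_sin (x := θ / 2) (by rw [abs_div]; simp; linarith)
  rw [abs_div, abs_two] at h4
  have : 2 / Real.pi * (|θ| / 2) = |θ| / Real.pi := by field_simp
  linarith

lemma fr_pointwise (s p r a θ : ℝ) (hs : -1 < s) (hp : 0 < p) (hr0 : 0 ≤ r) (hr1 : r < 1)
    (ha0 : 0 ≤ a) (ha1 : a < 1) (hθ : |θ| ≤ Real.pi) :
    (1 - r ^ 2) ^ s * ‖1 - (r * Complex.exp (θ * I)) * (a:ℂ)‖ ^ (-(2 + s + p)) ≤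
      (2 ^ |s| * Real.pi ^ (1 + p / 2)) *
      ((1 - r) ^ s * (max (1 - r) (1 - a)) ^ (-(1 + s + p / 2)) *
       (|θ| ^ (0:ℝ) * (max |θ| (1 - a)) ^ (-(1 + 0 + p / 2)))) := by
  obtain ⟨h1, h2, h3⟩ := fr_lower r a θ hr0 hr1 ha0 ha1 hθ
  set W := ‖1 - (r * Complex.exp (θ * I)) * (a:ℂ)‖
  have hW : 0 < W := by linarith
  have hx : 0 < 1 - r := by linarith
  have hd : 0 < 1 - a := by linarith
  have hpi := Real.pi_pos
  have hm1 : 0 < max (1 - r) (1 - a) := lt_max_of_lt_left hx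
  have hm2 : 0 < max |θ| (1 - a) := lt_max_of_lt_right hd
  have e : W ^ (-(2 + s + p)) = W ^ (-(1 + s + p / 2)) * W ^ (-(1 + p / 2)) := by
    rw [← Real.rpow_add hW]; congr 1; ring
  have b1 : W ^ (-(1 + s + p / 2)) ≤ (max (1 - r) (1 - a)) ^ (-(1 + s + p / 2)) :=
    Real.rpow_le_rpow_of_nonpos hm1 (max_le h1 h2) (by linarith)
  have b2 : W ^ (-(1 + p / 2)) ≤ Real.pi ^ (1 + p / 2) * (max |θ| (1 - a)) ^ (-(1 + p / 2)) := by
    have : max |θ| (1 - a) / Real.pi ≤ W := by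
      rw [div_le_iff₀ hpi]
      refine max_le ((div_le_iff₀ hpi).1 h3) ?_
      have := Real.pi_gt_three
      nlinarith
    refine (Real.rpow_le_rpow_of_nonpos (by positivity) this (by linarith)).trans (le_of_eq ?_)
    rw [Real.div_rpow hm2.le hpi.le, Real.rpow_neg hpi.le, div_inv_eq_mul, mul_comm]
  have b3 : (1 - r ^ 2) ^ s ≤ 2 ^ |s| * (1 - r) ^ s := by
    have : 1 - r ^ 2 = (1 + r) * (1 - r) := by ring
    rw [this, Real.mul_rpow (by linarith) hx.le]
    gcongr
    calc (1 + r) ^ s ≤ (1 + r) ^ |s| := Real.rpow_le_rpow_of_exponent_le (by linarith) (le_abs_self s)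
      _ ≤ 2 ^ |s| := Real.rpow_le_rpow (by linarith) (by linarith) (abs_nonneg s)
  rw [e, Real.rpow_zero, one_mul, add_zero]
  calc _ ≤ (2 ^ |s| * (1 - r) ^ s) * ((max (1 - r) (1 - a)) ^ (-(1 + s + p / 2)) *
        (Real.pi ^ (1 + p / 2) * (max |θ| (1 - a)) ^ (-(1 + p / 2)))) := by gcongr
    _ = _ := by ring

lemma fr_real (s p : ℝ) (hs : -1 < s) (hp : 0 < p) :
    ∃ C : ℝ, 0 < C ∧ ∀ a : ℝ, 0 ≤ a → a < 1 →
      ∫⁻ z in unitDisk, ENNReal.ofReal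
        ((1 - ‖z‖ ^ 2) ^ s * ‖1 - z * (a:ℂ)‖ ^ (-(2 + s + p))) ≤
        ENNReal.ofReal (C * (1 - a) ^ (-p)) := by
  have hs1 : 0 < s + 1 := by linarith
  have hpi := Real.pi_pos
  refine ⟨(2 ^ |s| * Real.pi ^ (1 + p / 2)) * ((1 / (s + 1) + 1 / (p / 2)) *
    (2 * (1 / (0 + 1) + 1 / (p / 2)))), by positivity, ?_⟩
  intro a ha0 ha1
  have hd : 0 < 1 - a := by linarith
  have hmD : MeasurableSet unitDisk := measurableSet_lt measurable_norm measurable_const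
  set K : ℝ := 2 ^ |s| * Real.pi ^ (1 + p / 2) with hK
  have hK0 : 0 < K := by positivity
  set G : ℝ → ENNReal := fun x => ENNReal.ofReal (x ^ s * (max x (1 - a)) ^ (-(1 + s + p / 2)))
    with hG
  set H : ℝ → ENNReal := fun x => ENNReal.ofReal (x ^ (0:ℝ) * (max x (1 - a)) ^ (-(1 + 0 + p / 2)))
    with hH
  have hGm : Measurable G := by rw [hG]; fun_prop
  have hHm : Measurable H := by rw [hH]; fun_prop
  set G' : ℝ → ENNReal := (Set.Ioi (0:ℝ)).indicator G with hG'
  have hGm' : Measurable G' := hGm.indicator measurableSet_Ioi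
  rw [← lintegral_indicator hmD, ← Complex.lintegral_comp_polarCoord_symm]
  have hb : ∀ q ∈ polarCoord.target, ENNReal.ofReal q.1 • (unitDisk.indicator (fun z : ℂ =>
      ENNReal.ofReal ((1 - ‖z‖ ^ 2) ^ s * ‖1 - z * (a:ℂ)‖ ^ (-(2 + s + p)))))
        (Complex.polarCoord.symm q) ≤ ENNReal.ofReal K * (G' (1 - q.1) * H |q.2|) := by
    rintro ⟨r, θ⟩ ⟨hr, hθ⟩
    have hr : 0 < r := hr
    have hθ : |θ| ≤ Real.pi := abs_le.2 ⟨hθ.1.le, hθ.2.le⟩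
    have hz : Complex.polarCoord.symm (r, θ) = r * Complex.exp (θ * I) := by
      rw [Complex.polarCoord_symm_apply, Complex.exp_mul_I]; simp
    have hzn : ‖(r:ℂ) * Complex.exp (θ * I)‖ = r := by
      rw [norm_mul, Complex.norm_exp_ofReal_mul_I, Complex.norm_real, Real.norm_eq_abs,
        abs_of_pos hr, mul_one]
    rw [hz]
    by_cases h1 : r < 1
    · have hmem : (r:ℂ) * Complex.exp (θ * I) ∈ unitDisk := by
        change ‖(r:ℂ) * Complex.exp (θ * I)‖ < 1
        rwa [hzn]
      have hmem' : 1 - r ∈ Set.Ioi (0:ℝ) := by simpa using h1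
      have hx : 0 < 1 - r := hmem'
      rw [Set.indicator_of_mem hmem, hzn, hG']
      simp only []
      rw [Set.indicator_of_mem hmem', hG, hH]
      simp only []
      rw [← ENNReal.ofReal_mul (by positivity), ← ENNReal.ofReal_mul hK0.le, smul_eq_mul]
      calc _ ≤ 1 * ENNReal.ofReal _ := by
            gcongr
            simpa using h1.le
        _ ≤ _ := by
            rw [one_mul]
            exact ENNReal.ofReal_le_ofReal (fr_pointwise s p r a θ hs hp hr.le h1 ha0 ha1 hθ)
    · rw [Set.indicator_of_notMem]
      · simp
      · intro h
        have : ‖(r:ℂ) * Complex.exp (θ * I)‖ < 1 := h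
        rw [hzn] at this
        exact h1 this
  refine (setLIntegral_mono' polarCoord.open_target.measurableSet hb).trans ?_
  refine (setLIntegral_le_lintegral _ _).trans ?_
  rw [lintegral_const_mul _ (by fun_prop), Measure.volume_eq_prod,
    lintegral_prod_mul (f := fun r => G' (1 - r)) (g := fun t => H |t|)
      (by fun_prop) (by fun_prop),
    lintegral_sub_left_eq_self G' 1, hG', lintegral_indicator measurableSet_Ioi]
  have i1 := fr_oneD s (p / 2) (1 - a) hs (by linarith) hd
  have i2 := fr_oneD 0 (p / 2) (1 - a) (by norm_num) (by linarith) hd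
  calc _ ≤ ENNReal.ofReal K * (ENNReal.ofReal ((1 / (s + 1) + 1 / (p / 2)) * (1 - a) ^ (-(p / 2))) *
        (ENNReal.ofReal 2 * ENNReal.ofReal ((1 / (0 + 1) + 1 / (p / 2)) * (1 - a) ^ (-(p / 2))))) := by
        gcongr
        refine (lintegral_abs_le H).trans ?_
        rw [ENNReal.ofReal_ofNat]
        gcongr
    _ = _ := by
        rw [← ENNReal.ofReal_mul (by positivity), ← ENNReal.ofReal_mul (by positivity),
          ← ENNReal.ofReal_mul (by positivity)]
        congr 1
        have : (1 - a) ^ (-p) = (1 - a) ^ (-(p / 2)) * (1 - a) ^ (-(p / 2)) := by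
          rw [← Real.rpow_add hd]; congr 1; ring
        rw [this]; ring

lemma fr_complex (s p : ℝ) (hs : -1 < s) (hp : 0 < p) :
    ∃ C : ℝ, 0 < C ∧ ∀ a : ℂ, ‖a‖ < 1 →
      ∫⁻ z in unitDisk, ENNReal.ofReal
        ((1 - ‖z‖ ^ 2) ^ s * ‖1 - z * (starRingEnd ℂ) a‖ ^ (-(2 + s + p))) ≤
        ENNReal.ofReal (C * (1 - ‖a‖) ^ (-p)) := by
  obtain ⟨C, hC, h⟩ := fr_real s p hs hp
  refine ⟨C, hC, fun a ha => ?_⟩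
  have hmD : MeasurableSet unitDisk := measurableSet_lt measurable_norm measurable_const
  refine le_trans (le_of_eq ?_) (h ‖a‖ (norm_nonneg a) ha)
  -- rotate by the argument of a
  set u : Circle := Circle.exp (-a.arg) with hu
  have hua : (u : ℂ) * ‖a‖ = (starRingEnd ℂ) a := by
    conv_rhs => rw [← Complex.norm_mul_exp_arg_mul_I a]
    rw [hu, Circle.coe_exp, map_mul, Complex.conj_ofReal, ← Complex.exp_conj]
    simp [mul_comm]
  have hmp := (rotation u).measurePreserving
  rw [← lintegral_indicator hmD, ← lintegral_indicator hmD]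
  symm
  rw [← hmp.lintegral_comp_emb (rotation u).toHomeomorph.measurableEmbedding]
  congr 1
  ext z
  have hn : ‖(rotation u) z‖ = ‖z‖ := (rotation u).norm_map z
  have e : 1 - (rotation u) z * (‖a‖ : ℂ) = 1 - z * (starRingEnd ℂ) a := by
    rw [← hua, rotation_apply]; ring
  by_cases hz : ‖z‖ < 1
  · have m1 : z ∈ unitDisk := hz
    have m2 : (rotation u) z ∈ unitDisk := by
      change ‖(rotation u) z‖ < 1
      rwa [hn]
    rw [Set.indicator_of_mem m1, Set.indicator_of_mem m2, hn, e]
  · have m1 : z ∉ unitDisk := hz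
    have m2 : (rotation u) z ∉ unitDisk := by
      change ¬ ‖(rotation u) z‖ < 1
      rwa [hn]
    rw [Set.indicator_of_notMem m1, Set.indicator_of_notMem m2]

lemma ennreal_tsum_rpow_le (f : ℕ → ENNReal) (p : ℝ) (hp0 : 0 < p) (hp1 : p ≤ 1) :
    (∑' n, f n) ^ p ≤ ∑' n, f n ^ p := by
  have hfin : ∀ s : Finset ℕ, (∑ n ∈ s, f n) ^ p ≤ ∑ n ∈ s, f n ^ p := by
    intro s
    classical
    induction s using Finset.induction_on with
    | empty => simp [hp0]
    | insert a s ha ih =>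
      rw [Finset.sum_insert ha, Finset.sum_insert ha]
      exact (ENNReal.rpow_add_le_add_rpow _ _ hp0.le hp1).trans (by gcongr)
  have ht : Filter.Tendsto (fun s : Finset ℕ => (∑ n ∈ s, f n) ^ p) Filter.atTop
      (nhds ((∑' n, f n) ^ p)) :=
    (ENNReal.continuous_rpow_const.tendsto _).comp ENNReal.summable.hasSum
  exact le_of_tendsto ht (Filter.Eventually.of_forall fun s =>
    (hfin s).trans (ENNReal.sum_le_tsum s))

theorem stmt11 (p : ℝ) (hp0 : 0 < p) (hp1 : p ≤ 1) (k : ℕ) (hk : 1 ≤ k)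
    (hpk : 1 < p * k) :
    ∃ C : ℝ, 0 < C ∧
      ∀ (c : ℕ → ℂ) (zs : ℕ → ℂ), (∀ n, ‖zs n‖ < 1) →
        Summable (fun n => ‖c n‖ ^ p) →
        (∫⁻ z in unitDisk,
            ENNReal.ofReal
              (‖∑' n, c n * (((1 : ℝ) - ‖zs n‖ ^ 2 : ℝ) : ℂ) /
                  (1 - z * (starRingEnd ℂ) (zs n)) ^ (k + 1)‖ ^ p *
                (1 - ‖z‖ ^ 2) ^ (p * k - 2)) ∂areaM) ≤
          ENNReal.ofReal (C * ∑' n, ‖c n‖ ^ p) := by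
  obtain ⟨C, hC, h⟩ := fr_complex (p * k - 2) p (by linarith) hp0
  refine ⟨2 ^ p * C, by positivity, ?_⟩
  intro c zs hzs hc
  have hmD : MeasurableSet unitDisk := measurableSet_lt measurable_norm measurable_const
  have hle : areaM ≤ (volume : Measure ℂ) := by
    refine Measure.le_iff.2 fun t _ => ?_
    rw [areaM, Measure.smul_apply, smul_eq_mul]
    calc _ ≤ 1 * (volume : Measure ℂ) t := by
          gcongr
          rw [ENNReal.inv_le_one, ENNReal.one_le_ofReal]
          linarith [Real.pi_gt_three]
      _ = _ := one_mul _
  refine (lintegral_mono' (Measure.restrict_mono_measure hle _) le_rfl).trans ?_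
  set F : ℕ → ℂ → ENNReal := fun n z => ENNReal.ofReal (‖c n‖ ^ p * (1 - ‖zs n‖ ^ 2) ^ p) *
    ENNReal.ofReal ((1 - ‖z‖ ^ 2) ^ (p * k - 2) *
      ‖1 - z * (starRingEnd ℂ) (zs n)‖ ^ (-(2 + (p * k - 2) + p))) with hF
  have hpos : ∀ n, 0 < 1 - ‖zs n‖ ^ 2 := fun n => by nlinarith [hzs n, norm_nonneg (zs n)]
  have hb : ∀ z ∈ unitDisk, ENNReal.ofReal
              (‖∑' n, c n * (((1 : ℝ) - ‖zs n‖ ^ 2 : ℝ) : ℂ) /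
                  (1 - z * (starRingEnd ℂ) (zs n)) ^ (k + 1)‖ ^ p *
                (1 - ‖z‖ ^ 2) ^ (p * k - 2)) ≤ ∑' n, F n z := by
    intro z hz
    have hz : ‖z‖ < 1 := hz
    have hz2 : 0 < 1 - ‖z‖ ^ 2 := by nlinarith [norm_nonneg z]
    rw [ENNReal.ofReal_mul (by positivity), ← ENNReal.ofReal_rpow_of_nonneg (norm_nonneg _) hp0.le,
      ofReal_norm]
    have h1 := (ENNReal.rpow_le_rpow (enorm_tsum_le_tsum_enorm (f := fun n =>
      c n * (((1 : ℝ) - ‖zs n‖ ^ 2 : ℝ) : ℂ) / (1 - z * (starRingEnd ℂ) (zs n)) ^ (k + 1)))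
        hp0.le).trans (ennreal_tsum_rpow_le _ p hp0 hp1)
    refine (mul_le_mul_left h1 _).trans (le_of_eq ?_)
    rw [← ENNReal.tsum_mul_right]
    congr 1
    ext n
    have hn := hpos n
    rw [← ofReal_norm, ENNReal.ofReal_rpow_of_nonneg (norm_nonneg _) hp0.le, hF,
      ← ENNReal.ofReal_mul (by positivity)]
    simp only []
    rw [← ENNReal.ofReal_mul (by positivity)]
    congr 1
    rw [norm_div, norm_mul, norm_pow, Complex.norm_real, Real.norm_eq_abs, abs_of_pos hn,
      Real.div_rpow (by positivity) (by positivity), Real.mul_rpow (by positivity) hn.le,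
      ← Real.rpow_natCast _ (k + 1), ← Real.rpow_mul (norm_nonneg _), div_eq_mul_inv,
      ← Real.rpow_neg (norm_nonneg _)]
    have : -(((k + 1 : ℕ) : ℝ) * p) = -(2 + (p * k - 2) + p) := by push_cast; ring
    rw [this]; ring
  refine (setLIntegral_mono' hmD hb).trans ?_
  rw [lintegral_tsum (fun n => by rw [hF]; fun_prop), ← tsum_mul_left,
    ENNReal.ofReal_tsum_of_nonneg (fun n => by positivity) (hc.mul_left _)]
  refine ENNReal.tsum_le_tsum fun n => ?_
  rw [hF]
  simp only []
  have hn := hpos n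
  have hn' : 0 < 1 - ‖zs n‖ := by linarith [hzs n]
  rw [lintegral_const_mul _ (by fun_prop)]
  refine (mul_le_mul_right (h (zs n) (hzs n)) _).trans ?_
  rw [← ENNReal.ofReal_mul (by positivity)]
  refine ENNReal.ofReal_le_ofReal ?_
  have h2 : (1 - ‖zs n‖ ^ 2) ^ p ≤ 2 ^ p * (1 - ‖zs n‖) ^ p := by
    rw [← Real.mul_rpow (by norm_num) hn'.le]
    refine Real.rpow_le_rpow hn.le ?_ hp0.le
    nlinarith [hzs n, norm_nonneg (zs n)]
  have h3 : (1 - ‖zs n‖) ^ p * (1 - ‖zs n‖) ^ (-p) = 1 := by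
    rw [← Real.rpow_add hn']; simp
  calc _ ≤ ‖c n‖ ^ p * (2 ^ p * (1 - ‖zs n‖) ^ p) * (C * (1 - ‖zs n‖) ^ (-p)) := by gcongr
    _ = 2 ^ p * C * ‖c n‖ ^ p * ((1 - ‖zs n‖) ^ p * (1 - ‖zs n‖) ^ (-p)) := by ring
    _ = _ := by rw [h3, mul_one]
end

section
/- There exist a Bloch function on the unit disk that is not in BMOA; consequently there exists a positive Borel measure μ on D that is 1-Carleson (μ(D(z,r)) ≤ C(1-|z|²) for all z) but is not a classical Carleson measure (i.e., there is no constant C with μ(S_h) ≤ C·h for all Carleson squares S_h of side length h). -/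
open MeasureTheory Complex

/-- The Carleson square of side length h at angular position θ₀. -/
def carlesonSquare (θ₀ h : ℝ) : Set ℂ :=
  {z : ℂ | 1 - h ≤ ‖z‖ ∧ ‖z‖ < 1 ∧ ∃ θ : ℝ, |θ - θ₀| ≤ h ∧ z = ↑‖z‖ * Complex.exp (θ * Complex.I)}


noncomputable def lacF (w : ℂ) : ℂ := ∑' n : ℕ, w ^ (100 ^ n)

lemma lac_le_pow {ρ : ℝ} (h0 : 0 ≤ ρ) (h1 : ρ < 1) (n : ℕ) : ρ ^ (100 ^ n) ≤ ρ ^ n :=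
  pow_le_pow_of_le_one h0 h1.le (Nat.lt_pow_self (by norm_num)).le

lemma lac_bound {ρ : ℝ} (h1 : ρ < 1) (n : ℕ) (w : ℂ) (hw : w ∈ Metric.ball (0 : ℂ) ρ) :
    ‖w ^ (100 ^ n)‖ ≤ ρ ^ n := by
  have hw' : ‖w‖ < ρ := by simpa using hw
  rw [norm_pow]
  have h0 : 0 ≤ ρ := (norm_nonneg w).trans hw'.le
  exact (pow_le_pow_left₀ (norm_nonneg _) hw'.le _).trans (lac_le_pow h0 h1 n)

lemma lac_diff (z : ℂ) (hz : ‖z‖ < 1) : DifferentiableAt ℂ lacF z := by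
  obtain ⟨ρ, h1, h2⟩ := exists_between hz
  have h0 : 0 ≤ ρ := (norm_nonneg z).trans h1.le
  have := Complex.differentiableOn_tsum_of_summable_norm (U := Metric.ball (0 : ℂ) ρ)
    (F := fun (n : ℕ) (w : ℂ) => w ^ (100 ^ n)) (u := fun n => ρ ^ n)
    (summable_geometric_of_lt_one h0 h2) (fun i => by fun_prop) Metric.isOpen_ball
    (fun i w hw => lac_bound h2 i w hw)
  exact this.differentiableAt (Metric.isOpen_ball.mem_nhds (by simpa using h1))

lemma lac_hasSum (z : ℂ) (hz : ‖z‖ < 1) :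
    HasSum (fun n : ℕ => ((100 ^ n : ℕ) : ℂ) * z ^ (100 ^ n - 1)) (deriv lacF z) := by
  obtain ⟨ρ, h1, h2⟩ := exists_between hz
  have h0 : 0 ≤ ρ := (norm_nonneg z).trans h1.le
  have := Complex.hasSum_deriv_of_summable_norm (U := Metric.ball (0 : ℂ) ρ) (z := z)
    (F := fun (n : ℕ) (w : ℂ) => w ^ (100 ^ n)) (u := fun n => ρ ^ n)
    (summable_geometric_of_lt_one h0 h2) (fun i => by fun_prop) Metric.isOpen_ball
    (fun i w hw => lac_bound h2 i w hw) (by simpa using h1)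
  have e : (fun n : ℕ => ((100 ^ n : ℕ) : ℂ) * z ^ (100 ^ n - 1))
      = fun i : ℕ => deriv (fun w : ℂ => w ^ (100 ^ i)) z := by
    funext n
    rw [deriv_pow_field]
  rw [e]
  exact this

lemma lac_partial (r : ℝ) (h0 : 0 ≤ r) (h1 : r < 1) (m : ℕ) :
    ∑ n ∈ Finset.range (m + 1), ((100 ^ n : ℕ) : ℝ) * r ^ (100 ^ n - 1)
      ≤ 2 * ∑ k ∈ Finset.range (100 ^ m), r ^ k := by
  induction m with
  | zero => simp
  | succ m ih =>
    rw [Finset.sum_range_succ,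
      ← Finset.sum_range_add_sum_Ico _ (Nat.pow_le_pow_right (by norm_num : 0 < 100) m.le_succ)]
    have key : ((Finset.Ico (100 ^ m) (100 ^ (m + 1))).card : ℝ) * r ^ (100 ^ (m + 1) - 1)
        ≤ ∑ k ∈ Finset.Ico (100 ^ m) (100 ^ (m + 1)), r ^ k := by
      rw [← nsmul_eq_mul]
      apply Finset.card_nsmul_le_sum
      intro k hk
      rw [Finset.mem_Ico] at hk
      exact pow_le_pow_of_le_one h0 h1.le (by omega)
    have hc : ((Finset.Ico (100 ^ m) (100 ^ (m + 1))).card : ℝ) = 99 * 100 ^ m := by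
      rw [Nat.card_Ico, Nat.cast_sub (Nat.pow_le_pow_right (by norm_num) m.le_succ)]
      push_cast
      rw [Nat.succ_eq_add_one, pow_succ]
      ring
    rw [hc] at key
    have hp : 0 ≤ (100 : ℝ) ^ m * r ^ (100 ^ (m + 1) - 1) := by positivity
    have e : ((100 ^ (m + 1) : ℕ) : ℝ) = 100 * 100 ^ m := by push_cast; ring
    rw [e]
    nlinarith

lemma lac_upper (z : ℂ) (hz : ‖z‖ < 1) : (1 - ‖z‖) * ‖deriv lacF z‖ ≤ 2 := by
  have h0 : 0 < 1 - ‖z‖ := by linarith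
  suffices h : ‖deriv lacF z‖ ≤ 2 * (1 - ‖z‖)⁻¹ by
    calc (1 - ‖z‖) * ‖deriv lacF z‖ ≤ (1 - ‖z‖) * (2 * (1 - ‖z‖)⁻¹) := by gcongr
      _ = 2 := by field_simp
  have ht := ((lac_hasSum z hz).tendsto_sum_nat.comp (Filter.tendsto_add_atTop_nat 1)).norm
  refine le_of_tendsto' ht fun m => ?_
  refine (norm_sum_le _ _).trans ?_
  have := lac_partial ‖z‖ (norm_nonneg _) hz m
  have h3 : ∑ k ∈ Finset.range (100 ^ m), ‖z‖ ^ k ≤ (1 - ‖z‖)⁻¹ := by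
    rw [← tsum_geometric_of_lt_one (norm_nonneg _) hz]
    exact (summable_geometric_of_lt_one (norm_nonneg _) hz).sum_le_tsum _
      (fun _ _ => by positivity)
  simp only [norm_mul, norm_pow, Complex.norm_natCast]
  linarith

lemma lac_geom (n : ℕ) :
    ∑ k ∈ Finset.range n, (100 : ℝ) ^ k ≤ (1 / 99) * 100 ^ n := by
  induction n with
  | zero => simp
  | succ n ih => rw [Finset.sum_range_succ, pow_succ]; linarith

lemma lac_tail (x : ℝ) (h0 : 0 ≤ x) (h1 : x ≤ 2 / 3) (m : ℕ) :
    ∑ j ∈ Finset.range m, (100 : ℝ) ^ (j + 1) * x ^ (100 ^ (j + 1)) ≤ 1 / 50 := by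
  have hx : x ^ 100 ≤ (1 / 10000 : ℝ) :=
    (pow_le_pow_left₀ h0 h1 100).trans (by norm_num)
  have hterm : ∀ j : ℕ, (100 : ℝ) ^ (j + 1) * x ^ (100 ^ (j + 1)) ≤ (1 / 100) * (1 / 100) ^ j := by
    intro j
    have : x ^ (100 ^ (j + 1)) ≤ (1 / 10000 : ℝ) ^ (j + 1) := by
      rw [pow_succ, mul_comm, pow_mul]
      have hj : j + 1 ≤ 100 ^ j := Nat.lt_pow_self (by norm_num)
      calc (x ^ 100) ^ (100 ^ j) ≤ (x ^ 100) ^ (j + 1) :=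
            pow_le_pow_of_le_one (by positivity) (by linarith) hj
        _ ≤ _ := pow_le_pow_left₀ (by positivity) hx _
    calc (100 : ℝ) ^ (j + 1) * x ^ (100 ^ (j + 1))
        ≤ 100 ^ (j + 1) * (1 / 10000 : ℝ) ^ (j + 1) := by gcongr
      _ = (1 / 100) ^ (j + 1) := by rw [← mul_pow]; norm_num
      _ = _ := by rw [pow_succ]; ring
  refine (Finset.sum_le_sum fun j _ => hterm j).trans ?_
  rw [← Finset.mul_sum]
  have : ∑ j ∈ Finset.range m, (1 / 100 : ℝ) ^ j ≤ 100 / 99 := by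
    have := (summable_geometric_of_lt_one (r := (1 / 100 : ℝ)) (by norm_num)
      (by norm_num)).sum_le_tsum (Finset.range m) (fun _ _ => by positivity)
    rw [tsum_geometric_of_lt_one (by norm_num) (by norm_num)] at this
    norm_num at this ⊢
    linarith
  linarith

lemma lac_lower (z : ℂ) (hz : ‖z‖ < 1) (n : ℕ) (hlo : 1 / 4 ≤ ‖z‖ ^ (100 ^ n))
    (hhi : ‖z‖ ^ (100 ^ n) ≤ 2 / 3) : (100 : ℝ) ^ n / 8 ≤ ‖deriv lacF z‖ := by
  have h1 : HasSum (fun k : ℕ => (100 : ℂ) ^ k * z ^ (100 ^ k)) (z * deriv lacF z) := by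
    have h := (lac_hasSum z hz).mul_left z
    refine Eq.mp (congrArg (fun g => HasSum g (z * deriv lacF z)) ?_) h
    funext k
    have : z ^ (100 ^ k) = z * z ^ (100 ^ k - 1) := by
      rw [← pow_succ', Nat.sub_add_cancel (Nat.one_le_pow _ _ (by norm_num))]
    rw [this]; push_cast; ring
  have h2 : (100 : ℝ) ^ n / 8 ≤ ‖z * deriv lacF z‖ := by
    have ht := (h1.tendsto_sum_nat.comp (Filter.tendsto_add_atTop_nat (n + 1))).norm
    refine ge_of_tendsto' ht fun m => ?_
    have e : (∑ k ∈ Finset.range (m + (n + 1)), (100 : ℂ) ^ k * z ^ (100 ^ k))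
        = (∑ k ∈ Finset.range n, (100 : ℂ) ^ k * z ^ (100 ^ k)) + (100 : ℂ) ^ n * z ^ (100 ^ n)
          + ∑ j ∈ Finset.range m, (100 : ℂ) ^ (n + 1 + j) * z ^ (100 ^ (n + 1 + j)) := by
      rw [add_comm m, Finset.sum_range_add, Finset.sum_range_succ]
    have hA : ‖∑ k ∈ Finset.range n, (100 : ℂ) ^ k * z ^ (100 ^ k)‖ ≤ (1 / 99) * 100 ^ n := by
      refine (norm_sum_le _ _).trans (le_trans (Finset.sum_le_sum fun k _ => ?_) (lac_geom n))
      rw [norm_mul, norm_pow, norm_pow]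
      have := pow_le_one₀ (n := 100 ^ k) (norm_nonneg z) hz.le
      have h3 : ‖(100 : ℂ)‖ = 100 := by simp
      rw [h3]
      exact mul_le_of_le_one_right (by positivity) this
    have hB : ‖∑ j ∈ Finset.range m, (100 : ℂ) ^ (n + 1 + j) * z ^ (100 ^ (n + 1 + j))‖
        ≤ 100 ^ n * (1 / 50) := by
      refine (norm_sum_le _ _).trans ?_
      refine le_trans (le_of_eq ?_) (mul_le_mul_of_nonneg_left
        (lac_tail (‖z‖ ^ (100 ^ n)) (by positivity) hhi m) (by positivity))
      rw [Finset.mul_sum]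
      refine Finset.sum_congr rfl fun j _ => ?_
      have h3 : ‖(100 : ℂ)‖ = 100 := by simp
      rw [norm_mul, norm_pow, norm_pow, h3, ← pow_mul, ← pow_add, ← mul_assoc, ← pow_add]
      congr 2 <;> ring
    have hC : (100 : ℝ) ^ n * (1 / 4) ≤ ‖(100 : ℂ) ^ n * z ^ (100 ^ n)‖ := by
      have h3 : ‖(100 : ℂ)‖ = 100 := by simp
      rw [norm_mul, norm_pow, norm_pow, h3]
      gcongr
    have hp : (0 : ℝ) < 100 ^ n := by positivity
    show _ ≤ ‖∑ k ∈ Finset.range (m + (n + 1)), (100 : ℂ) ^ k * z ^ (100 ^ k)‖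
    rw [e]
    generalize (∑ k ∈ Finset.range n, (100 : ℂ) ^ k * z ^ (100 ^ k)) = A at *
    generalize (∑ j ∈ Finset.range m, (100 : ℂ) ^ (n + 1 + j) * z ^ (100 ^ (n + 1 + j))) = B at *
    generalize (100 : ℂ) ^ n * z ^ (100 ^ n) = T at *
    have : ‖T‖ ≤ ‖A + T + B‖ + ‖A‖ + ‖B‖ := by
      calc ‖T‖ = ‖(A + T + B) - A - B‖ := by congr 1; ring
        _ ≤ ‖(A + T + B) - A‖ + ‖B‖ := norm_sub_le _ _
        _ ≤ _ := by gcongr; exact norm_sub_le _ _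
    linarith
  rw [norm_mul] at h2
  nlinarith [norm_nonneg (deriv lacF z)]

lemma areaM_le (s : Set ℂ) (z : ℂ) (R : ℝ) (hR : 0 ≤ R) (h : s ⊆ Metric.ball z R) :
    areaM s ≤ ENNReal.ofReal (R ^ 2) := by
  refine (measure_mono h).trans (le_of_eq ?_)
  rw [areaM, Measure.smul_apply, Complex.volume_ball, smul_eq_mul, ← ENNReal.ofReal_pow hR]
  have : (NNReal.pi : ENNReal) = ENNReal.ofReal Real.pi := by
    rw [ENNReal.ofReal, ← NNReal.coe_real_pi, Real.toNNReal_coe]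
  rw [this, mul_comm (ENNReal.ofReal (R ^ 2)), ← mul_assoc, ENNReal.inv_mul_cancel, one_mul]
  · simp [Real.pi_pos]
  · simp

lemma areaM_ball (z : ℂ) (R : ℝ) (hR : 0 ≤ R) :
    areaM (Metric.ball z R) = ENNReal.ofReal (R ^ 2) := by
  rw [areaM, Measure.smul_apply, Complex.volume_ball, smul_eq_mul, ← ENNReal.ofReal_pow hR]
  have : (NNReal.pi : ENNReal) = ENNReal.ofReal Real.pi := by
    rw [ENNReal.ofReal, ← NNReal.coe_real_pi, Real.toNNReal_coe]
  rw [this, mul_comm (ENNReal.ofReal (R ^ 2)), ← mul_assoc, ENNReal.inv_mul_cancel, one_mul]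
  · simp [Real.pi_pos]
  · simp

def lacA (n : ℕ) : Set ℂ :=
  Metric.ball 0 (1 - 1 / (2 * 100 ^ n)) \ Metric.ball 0 (1 - 3 / (4 * 100 ^ n))

lemma lacA_meas (n : ℕ) : MeasurableSet (lacA n) :=
  Metric.isOpen_ball.measurableSet.diff Metric.isOpen_ball.measurableSet

lemma lacA_mem {n : ℕ} {z : ℂ} :
    z ∈ lacA n ↔ ‖z‖ < 1 - 1 / (2 * 100 ^ n) ∧ 1 - 3 / (4 * 100 ^ n) ≤ ‖z‖ := by
  simp [lacA]

lemma lacA_sub (n : ℕ) : lacA n ⊆ unitDisk := by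
  intro z hz
  have h := (lacA_mem.1 hz).1
  have : (0 : ℝ) < 1 / (2 * 100 ^ n) := by positivity
  show ‖z‖ < 1
  linarith

lemma lacA_area (n : ℕ) : ENNReal.ofReal (3 / (16 * 100 ^ n)) ≤ areaM (lacA n) := by
  have hN : (1 : ℝ) ≤ 100 ^ n := one_le_pow₀ (by norm_num)
  obtain ⟨t, ht⟩ : ∃ t : ℝ, t = 1 / 100 ^ n := ⟨_, rfl⟩
  have ht0 : 0 < t := by rw [ht]; positivity
  have ht1 : t ≤ 1 := by rw [ht, div_le_one (by positivity)]; exact hN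
  have e1 : (1 : ℝ) / (2 * 100 ^ n) = t / 2 := by rw [ht]; field_simp
  have e2 : (3 : ℝ) / (4 * 100 ^ n) = 3 / 4 * t := by rw [ht]; field_simp
  have e3 : (3 : ℝ) / (16 * 100 ^ n) = 3 / 16 * t := by rw [ht]; field_simp
  rw [lacA, e1, e2, e3]
  refine le_trans ?_ le_measure_sdiff
  rw [areaM_ball _ _ (by linarith), areaM_ball _ _ (by linarith),
    ← ENNReal.ofReal_sub _ (by positivity)]
  apply ENNReal.ofReal_le_ofReal
  nlinarith

lemma lacA_disj : Pairwise (Function.onFun Disjoint lacA) := by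
  have key : ∀ m n : ℕ, m < n → Disjoint (lacA m) (lacA n) := by
    intro m n hmn
    rw [Set.disjoint_left]
    intro z hm hn
    have h1 := (lacA_mem.1 hm).1
    have h2 := (lacA_mem.1 hn).2
    have h3 : (100 : ℝ) ^ (m + 1) ≤ 100 ^ n := pow_le_pow_right₀ (by norm_num) hmn
    have h4 : (3 : ℝ) / (4 * 100 ^ n) ≤ 3 / (4 * 100 ^ (m + 1)) := by gcongr
    have h5 : (3 : ℝ) / (4 * 100 ^ (m + 1)) ≤ 1 / (2 * 100 ^ m) := by
      rw [div_le_div_iff₀ (by positivity) (by positivity), pow_succ]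
      have : (0 : ℝ) < 100 ^ m := by positivity
      linarith
    linarith
  intro m n hmn
  rcases lt_or_gt_of_ne hmn with h | h
  · exact key m n h
  · exact (key n m h).symm

lemma lacA_dens (n : ℕ) (z : ℂ) (hz : z ∈ lacA n) :
    (100 : ℝ) ^ n / 128 ≤ (1 - ‖z‖ ^ 2) * ‖deriv lacF z‖ ^ 2 := by
  obtain ⟨h1, h2⟩ := lacA_mem.1 hz
  have hz1 : ‖z‖ < 1 := lacA_sub n hz
  have hN : (1 : ℝ) ≤ 100 ^ n := one_le_pow₀ (by norm_num)
  have hz0 := norm_nonneg z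
  have hlo : 1 / 4 ≤ ‖z‖ ^ (100 ^ n) := by
    have := one_add_mul_le_pow (a := ‖z‖ - 1) (by linarith) (100 ^ n)
    push_cast at this
    rw [add_sub_cancel] at this
    have h3 : (100 : ℝ) ^ n * (1 - ‖z‖) ≤ 100 ^ n * (3 / (4 * 100 ^ n)) := by
      gcongr; linarith
    have h4 : (100 : ℝ) ^ n * (3 / (4 * 100 ^ n)) = 3 / 4 := by field_simp
    linarith
  have hN2 : 1 / 2 ≤ (100 : ℝ) ^ n * (1 - ‖z‖) := by
    have h3 : (100 : ℝ) ^ n * (1 / (2 * 100 ^ n)) ≤ 100 ^ n * (1 - ‖z‖) := by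
      gcongr; linarith
    have h4 : (100 : ℝ) ^ n * (1 / (2 * 100 ^ n)) = 1 / 2 := by field_simp
    linarith
  have hhi : ‖z‖ ^ (100 ^ n) ≤ 2 / 3 := by
    have h5 : ‖z‖ ≤ Real.exp (-(1 - ‖z‖)) := by
      have := Real.add_one_le_exp (-(1 - ‖z‖)); linarith
    have h6 : ‖z‖ ^ (100 ^ n) ≤ Real.exp (-(1 / 2)) := by
      refine (pow_le_pow_left₀ hz0 h5 _).trans ?_
      rw [← Real.exp_nat_mul]
      apply Real.exp_le_exp.2
      push_cast
      linarith
    have h7 : (3 / 2 : ℝ) ≤ Real.exp (1 / 2) := by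
      have := Real.add_one_le_exp (1 / 2 : ℝ); linarith
    rw [Real.exp_neg] at h6
    have h8 := inv_anti₀ (by norm_num) h7
    norm_num at h8 h6 ⊢
    linarith
  have hd := lac_lower z hz1 n hlo hhi
  have h9 : ((100 : ℝ) ^ n / 8) ^ 2 ≤ ‖deriv lacF z‖ ^ 2 := by gcongr
  calc (100 : ℝ) ^ n / 128 = (1 / 2) * 100 ^ n / 64 := by ring
    _ ≤ (100 ^ n * (1 - ‖z‖)) * 100 ^ n / 64 := by gcongr
    _ = (1 - ‖z‖) * ((100 : ℝ) ^ n / 8) ^ 2 := by ring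
    _ ≤ (1 - ‖z‖ ^ 2) * ‖deriv lacF z‖ ^ 2 := by
      apply mul_le_mul _ h9 (by positivity) _ <;> nlinarith

noncomputable def lacMu : Measure ℂ := (areaM.restrict unitDisk).withDensity
  (fun z => ENNReal.ofReal ((1 - ‖z‖ ^ 2) * ‖deriv lacF z‖ ^ 2))

lemma unitDisk_meas : MeasurableSet unitDisk :=
  measurableSet_lt measurable_norm measurable_const

lemma lacMu_A (n : ℕ) : ENNReal.ofReal (3 / 2048) ≤ lacMu (lacA n) := by
  rw [lacMu, withDensity_apply _ (lacA_meas n), Measure.restrict_restrict (lacA_meas n),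
    Set.inter_eq_left.2 (lacA_sub n)]
  calc ENNReal.ofReal (3 / 2048)
      = ENNReal.ofReal ((100 : ℝ) ^ n / 128) * ENNReal.ofReal (3 / (16 * 100 ^ n)) := by
        rw [← ENNReal.ofReal_mul (by positivity)]
        congr 1
        field_simp
        norm_num
    _ ≤ ENNReal.ofReal ((100 : ℝ) ^ n / 128) * areaM (lacA n) := by
        gcongr; exact lacA_area n
    _ = ∫⁻ _ in lacA n, ENNReal.ofReal ((100 : ℝ) ^ n / 128) ∂areaM := by
        rw [setLIntegral_const]
    _ ≤ _ := setLIntegral_mono' (lacA_meas n)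
        fun z hz => ENNReal.ofReal_le_ofReal (lacA_dens n z hz)

lemma lacMu_top : lacMu unitDisk = ⊤ := by
  rw [eq_top_iff]
  calc (⊤ : ENNReal) = ∑' _ : ℕ, ENNReal.ofReal (3 / 2048) :=
        (ENNReal.tsum_const_eq_top_of_ne_zero (by simp)).symm
    _ ≤ ∑' n, lacMu (lacA n) := ENNReal.tsum_le_tsum lacMu_A
    _ = lacMu (⋃ n, lacA n) := (measure_iUnion lacA_disj lacA_meas).symm
    _ ≤ _ := measure_mono (Set.iUnion_subset lacA_sub)

lemma disk_cover : unitDisk ⊆ (carlesonSquare (-3) 1 ∪ carlesonSquare (-1) 1) ∪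
    (carlesonSquare 1 1 ∪ carlesonSquare 3 1) := by
  intro z hz
  have hz' : ‖z‖ < 1 := hz
  have h1 := Complex.neg_pi_lt_arg z
  have h2 := Complex.arg_le_pi z
  have h3 := Real.pi_lt_four
  have key : ∀ θ : ℝ, |z.arg - θ| ≤ 1 → z ∈ carlesonSquare θ 1 := fun θ h =>
    ⟨by simp, hz', z.arg, h, (Complex.norm_mul_exp_arg_mul_I z).symm⟩
  rcases le_total z.arg (-2) with h | h
  · exact Or.inl (Or.inl (key _ (abs_le.2 ⟨by linarith, by linarith⟩)))
  rcases le_total z.arg 0 with h' | h'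
  · exact Or.inl (Or.inr (key _ (abs_le.2 ⟨by linarith, by linarith⟩)))
  rcases le_total z.arg 2 with h'' | h''
  · exact Or.inr (Or.inl (key _ (abs_le.2 ⟨by linarith, by linarith⟩)))
  · exact Or.inr (Or.inr (key _ (abs_le.2 ⟨by linarith, by linarith⟩)))

lemma pDisk_meas (z : ℂ) (r : ℝ) : MeasurableSet (pDisk z r) := by
  refine unitDisk_meas.inter (?_ : MeasurableSet
    {w : ℂ | ‖(z - w) / (1 - z * (starRingEnd ℂ) w)‖ < r})
  refine measurableSet_lt ?_ measurable_const
  have : Measurable (starRingEnd ℂ) := Complex.continuous_conj.measurable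
  fun_prop

lemma pDisk_est {z w : ℂ} {r : ℝ} (hr0 : 0 < r) (hr : r < 1) (hz : ‖z‖ < 1)
    (hw : w ∈ pDisk z r) :
    (1 - r ^ 2) / 4 * (1 - ‖z‖ ^ 2) ≤ 1 - ‖w‖ ^ 2 ∧
      ‖w - z‖ < 2 * (1 - ‖z‖ ^ 2) / (1 - r ^ 2) := by
  obtain ⟨hw1, hw2⟩ := hw
  have hw1 : ‖w‖ < 1 := hw1
  have hz0 := norm_nonneg z
  have hw0 := norm_nonneg w
  obtain ⟨d, hd⟩ : ∃ d : ℝ, d = ‖1 - z * (starRingEnd ℂ) w‖ := ⟨_, rfl⟩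
  have hzw : ‖z * (starRingEnd ℂ) w‖ = ‖z‖ * ‖w‖ := by rw [norm_mul, RCLike.norm_conj]
  have hd1 : 1 - ‖z‖ * ‖w‖ ≤ d := by
    have := norm_sub_norm_le (1 : ℂ) (z * (starRingEnd ℂ) w)
    rw [hzw, norm_one] at this
    rw [hd]; exact this
  have hdz : 1 - ‖z‖ ≤ d := by nlinarith
  have hdw : 1 - ‖w‖ ≤ d := by nlinarith
  have hdpos : 0 < d := by linarith
  have hid : d ^ 2 - ‖z - w‖ ^ 2 = (1 - ‖z‖ ^ 2) * (1 - ‖w‖ ^ 2) := by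
    rw [hd]
    simp only [Complex.sq_norm, Complex.normSq_apply]
    simp
    ring
  rw [norm_div, ← hd, div_lt_iff₀ hdpos] at hw2
  have hr2 : 0 < 1 - r ^ 2 := by nlinarith
  have hsq : ‖z - w‖ ^ 2 ≤ (r * d) ^ 2 := by gcongr
  have hA : 0 < 1 - ‖z‖ ^ 2 := by nlinarith
  have hB : 0 < 1 - ‖w‖ ^ 2 := by nlinarith
  have hmain : (1 - r ^ 2) * d ^ 2 ≤ (1 - ‖z‖ ^ 2) * (1 - ‖w‖ ^ 2) := by nlinarith
  have hAd : 1 - ‖z‖ ^ 2 ≤ 2 * d := by nlinarith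
  have hBd : 1 - ‖w‖ ^ 2 ≤ 2 * d := by nlinarith
  generalize 1 - ‖z‖ ^ 2 = A at *
  generalize 1 - ‖w‖ ^ 2 = B at *
  generalize 1 - r ^ 2 = s at *
  constructor
  · have h1 : s * A ^ 2 ≤ 4 * (A * B) := by
      have : A ^ 2 ≤ (2 * d) ^ 2 := by gcongr
      nlinarith
    have h2 : A * (s * A) ≤ A * (4 * B) := by linarith
    have := le_of_mul_le_mul_left h2 hA
    linarith
  · have h1 : d * (s * d) ≤ d * (2 * A) := by nlinarith
    have h2 := le_of_mul_le_mul_left h1 hdpos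
    rw [norm_sub_rev, lt_div_iff₀ hr2]
    nlinarith [norm_nonneg (z - w)]

lemma lacMu_pDisk {z : ℂ} {r : ℝ} (hr0 : 0 < r) (hr : r < 1) (hz : ‖z‖ < 1) :
    lacMu (pDisk z r) ≤ ENNReal.ofReal (256 / (1 - r ^ 2) ^ 3 * (1 - ‖z‖ ^ 2)) := by
  have hr2 : 0 < 1 - r ^ 2 := by nlinarith
  have hA : 0 < 1 - ‖z‖ ^ 2 := by nlinarith [norm_nonneg z]
  have hsub : pDisk z r ⊆ unitDisk := fun w hw => hw.1
  rw [lacMu, withDensity_apply _ (pDisk_meas z r), Measure.restrict_restrict (pDisk_meas z r),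
    Set.inter_eq_left.2 hsub]
  have hdens : ∀ w ∈ pDisk z r, (1 - ‖w‖ ^ 2) * ‖deriv lacF w‖ ^ 2
      ≤ 64 / ((1 - r ^ 2) * (1 - ‖z‖ ^ 2)) := by
    intro w hw
    have hw1 : ‖w‖ < 1 := hw.1
    have h1 := (pDisk_est hr0 hr hz hw).1
    have hB : 0 < 1 - ‖w‖ ^ 2 := by nlinarith [norm_nonneg w]
    have h2 := lac_upper w hw1
    have h3 : (1 - ‖w‖ ^ 2) * ‖deriv lacF w‖ ≤ 4 := by
      nlinarith [norm_nonneg w, norm_nonneg (deriv lacF w),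
        mul_nonneg (sub_nonneg.2 hw1.le) (norm_nonneg (deriv lacF w))]
    have h4 : ((1 - ‖w‖ ^ 2) * ‖deriv lacF w‖) ^ 2 ≤ 4 ^ 2 := by gcongr
    rw [le_div_iff₀ (by positivity)]
    generalize ‖deriv lacF w‖ = g at *
    generalize 1 - ‖w‖ ^ 2 = B at *
    generalize 1 - ‖z‖ ^ 2 = A at *
    generalize 1 - r ^ 2 = s at *
    calc B * g ^ 2 * (s * A) = B * g ^ 2 * 4 * (s / 4 * A) := by ring
      _ ≤ B * g ^ 2 * 4 * B := by gcongr
      _ = 4 * (B * g) ^ 2 := by ring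
      _ ≤ 64 := by linarith
  calc _ ≤ ∫⁻ _ in pDisk z r, ENNReal.ofReal (64 / ((1 - r ^ 2) * (1 - ‖z‖ ^ 2))) ∂areaM :=
        setLIntegral_mono' (pDisk_meas z r)
          fun w hw => ENNReal.ofReal_le_ofReal (hdens w hw)
    _ = ENNReal.ofReal (64 / ((1 - r ^ 2) * (1 - ‖z‖ ^ 2))) * areaM (pDisk z r) := by
        rw [setLIntegral_const]
    _ ≤ ENNReal.ofReal (64 / ((1 - r ^ 2) * (1 - ‖z‖ ^ 2))) *
        ENNReal.ofReal ((2 * (1 - ‖z‖ ^ 2) / (1 - r ^ 2)) ^ 2) := by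
        gcongr
        refine areaM_le _ z _ (by positivity) fun w hw => ?_
        rw [Metric.mem_ball, dist_eq_norm]
        exact (pDisk_est hr0 hr hz hw).2
    _ = _ := by
        rw [← ENNReal.ofReal_mul (by positivity)]
        congr 1
        field_simp
        norm_num

theorem stmt12 :
    ∃ f : ℂ → ℂ, DifferentiableOn ℂ f unitDisk ∧
      (∃ M : ℝ, ∀ z ∈ unitDisk, (1 - ‖z‖ ^ 2) * ‖deriv f z‖ ≤ M) ∧
      ∀ μ : Measure ℂ,
        μ = (areaM.restrict unitDisk).withDensity
              (fun z => ENNReal.ofReal ((1 - ‖z‖ ^ 2) * ‖deriv f z‖ ^ 2)) →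
        ((∀ r : ℝ, 0 < r → r < 1 →
            ∃ C : ℝ, 0 < C ∧
              ∀ z ∈ unitDisk, μ (pDisk z r) ≤ ENNReal.ofReal (C * (1 - ‖z‖ ^ 2))) ∧
          ¬ ∃ C : ℝ, ∀ h θ₀ : ℝ, 0 < h → h ≤ 1 →
              μ (carlesonSquare θ₀ h) ≤ ENNReal.ofReal (C * h)) := by
  refine ⟨lacF, fun z hz => (lac_diff z hz).differentiableWithinAt, ⟨4, fun z hz => ?_⟩, ?_⟩
  · have hz1 : ‖z‖ < 1 := hz
    have h2 := lac_upper z hz1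
    nlinarith [norm_nonneg z, norm_nonneg (deriv lacF z),
        mul_nonneg (sub_nonneg.2 hz1.le) (norm_nonneg (deriv lacF z))]
  intro μ hμ
  have hμ' : μ = lacMu := hμ
  subst hμ'
  refine ⟨fun r hr0 hr => ⟨256 / (1 - r ^ 2) ^ 3, ?_, fun z hz => lacMu_pDisk hr0 hr hz⟩, ?_⟩
  · have : 0 < 1 - r ^ 2 := by nlinarith
    positivity
  · rintro ⟨C, hC⟩
    have h : ∀ θ, lacMu (carlesonSquare θ 1) < ⊤ := fun θ =>
      (hC 1 θ one_pos le_rfl).trans_lt ENNReal.ofReal_lt_top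
    have h1 : lacMu unitDisk < ⊤ := by
      refine (measure_mono disk_cover).trans_lt ?_
      exact measure_union_lt_top (measure_union_lt_top (h _) (h _))
        (measure_union_lt_top (h _) (h _))
    rw [lacMu_top] at h1
    exact lt_irrefl _ h1
end
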